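/- arXiv:2110.13320 — 2 statements merged into one kernel-verified Lean document; each statement's English description precedes it below -/
import Mathlib

section
/- Let G be a finite group such that φ(S) ≠ 0 for every subgroup S of G. Then the following are equivalent: (i) for all subgroups H, K of G with H ⊆ K, φ(H) divides φ(K); (ii) G is nilpotent and each of its Sylow subgroups is cyclic, isomorphic to the quaternion group Q₈, or isomorphic to ℤ_p × ℤ_p for some prime p. -/
/-- For a finite group `G`, `phi G` is the number of elements of `G` whose order
equals the exponent of `G`. -/
noncomputable def phi (G : Type*) [Group G] : ℕ :=
  Nat.card {a : G // orderOf a = Monoid.exponent G}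

/-- `phi` is monotone for divisibility along inclusions of subgroups. -/
def PhiDvd (G : Type*) [Group G] : Prop :=
  ∀ H K : Subgroup G, H ≤ K → phi H ∣ phi K

section Basic

variable {G H : Type*} [Group G] [Group H]

lemma phi_congr (e : G ≃* H) : phi G = phi H := by
  unfold phi
  refine Nat.card_congr (e.toEquiv.subtypeEquiv fun a => ?_)
  rw [MulEquiv.toEquiv_eq_coe, MulEquiv.coe_toEquiv, MulEquiv.orderOf_eq,
    Monoid.exponent_eq_of_mulEquiv e]

lemma phi_map_subtype (H : Subgroup G) (K : Subgroup H) : phi (K.map H.subtype) = phi K :=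
  (phi_congr (K.equivMapOfInjective H.subtype H.subtype_injective)).symm

lemma PhiDvd.subgroup (h : PhiDvd G) (H : Subgroup G) : PhiDvd H := by
  intro A B hAB
  rw [← phi_map_subtype H A, ← phi_map_subtype H B]
  exact h _ _ (Subgroup.map_mono hAB)

lemma PhiDvd.dvd_phi (h : PhiDvd G) (H : Subgroup G) : phi H ∣ phi G := by
  rw [← phi_congr (Subgroup.topEquiv (G := G))]
  exact h _ _ le_top

lemma phi_of_isCyclic [Finite G] [IsCyclic G] : phi G = (Nat.card G).totient := by
  classical
  have := Fintype.ofFinite G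
  unfold phi
  rw [IsCyclic.exponent_eq_card, Nat.card_eq_fintype_card, Fintype.card_subtype,
    Nat.card_eq_fintype_card]
  exact IsCyclic.card_orderOf_eq_totient dvd_rfl

lemma PhiDvd.totient_dvd [Finite G] (h : PhiDvd G) (x : G) : (orderOf x).totient ∣ phi G := by
  rw [← Nat.card_zpowers, ← phi_of_isCyclic]
  exact h.dvd_phi _

lemma phi_pos [Finite G] {x : G} (hx : orderOf x = Monoid.exponent G) : 0 < phi G :=
  have : Nonempty {a : G // orderOf a = Monoid.exponent G} := ⟨⟨x, hx⟩⟩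
  Nat.card_pos

lemma phi_add_card_le [Finite G] (A : Subgroup G)
    (hA : ∀ a ∈ A, orderOf a ≠ Monoid.exponent G) : phi G + Nat.card A ≤ Nat.card G := by
  have h1 : phi G = {a : G | orderOf a = Monoid.exponent G}.ncard := rfl
  have h2 : Nat.card A = (A : Set G).ncard := rfl
  rw [h1, h2, ← Set.ncard_union_eq _ (Set.toFinite _) (Set.toFinite _)]
  · exact Set.ncard_le_card _
  · rw [Set.disjoint_left]
    exact fun a h1 h2 => hA a h2 h1

/-- Counting the elements of exponent order by counting the complement. -/
lemma phi_eq_card_sub [Finite G] (s : Set G)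
    (hs : ∀ a, a ∈ s ↔ orderOf a ≠ Monoid.exponent G) : phi G = Nat.card G - s.ncard := by
  have h1 : phi G = {a : G | orderOf a = Monoid.exponent G}.ncard := rfl
  rw [h1, ← Set.ncard_compl]
  congr 1
  ext a
  simp [hs]

lemma exponent_eq_of_forall_pow_prime [Nontrivial G] {p : ℕ} (hp : p.Prime)
    (h : ∀ x : G, x ^ p = 1) : Monoid.exponent G = p := by
  have := Fact.mk hp
  exact (Monoid.exponent_eq_prime_iff hp).2 fun g hg => orderOf_eq_prime (h g) hg

lemma phi_of_forall_pow_prime [Finite G] [Nontrivial G] {p : ℕ} (hp : p.Prime)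
    (h : ∀ x : G, x ^ p = 1) : phi G = Nat.card G - 1 := by
  have := Fact.mk hp
  rw [phi_eq_card_sub {1}, Set.ncard_singleton]
  intro a
  rw [exponent_eq_of_forall_pow_prime hp h, Set.mem_singleton_iff]
  constructor
  · rintro rfl
    simpa using hp.one_lt.ne
  · intro h1
    by_contra h2
    exact h1 (orderOf_eq_prime (h a) h2)

lemma IsPGroup.exists_orderOf_eq_exponent [Finite G] {p : ℕ} [Fact p.Prime] (hG : IsPGroup p G) :
    ∃ g : G, orderOf g = Monoid.exponent G := by
  obtain ⟨n, hn⟩ := isPGroup_iff_exponent_eq_pow.1 hG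
  obtain ⟨g, hg⟩ := Nat.Prime.exists_orderOf_eq_pow_factorization_exponent G (Fact.out : p.Prime)
  refine ⟨g, ?_⟩
  rw [hg, hn, (Fact.out : p.Prime).factorization_pow]
  simp

end Basic

section PGroup

variable {P : Type*} [Group P] [Finite P] {p : ℕ} [hp : Fact p.Prime]

lemma PhiDvd.card_le_sq (h : PhiDvd P) {k : ℕ} (hk : Nat.card P = p ^ k)
    (he : ∀ x : P, x ^ p = 1) : k ≤ 2 := by
  by_contra! hk2
  obtain ⟨A, hA⟩ := Sylow.exists_subgroup_card_pow_prime p (G := P) (n := 2)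
    (hk ▸ pow_dvd_pow p hk2.le)
  obtain ⟨K, hK, hAK⟩ := Sylow.exists_subgroup_card_pow_succ (G := P) (n := 2)
    (hk ▸ pow_dvd_pow p hk2) hA
  have hp2 := hp.out.two_le
  have nA : Nontrivial A := Finite.one_lt_card_iff_nontrivial.1 (hA ▸ by nlinarith)
  have nK : Nontrivial K := Finite.one_lt_card_iff_nontrivial.1 (hK ▸ by
    have : 1 < p ^ 2 := by nlinarith
    rw [pow_succ]; nlinarith)
  have := h A K hAK
  rw [phi_of_forall_pow_prime hp.out fun x => Subtype.ext (he x),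
    phi_of_forall_pow_prime hp.out fun x => Subtype.ext (he x), hA, hK] at this
  obtain ⟨q, rfl⟩ := Nat.exists_eq_add_of_le hp2
  have e1 : (2 + q) ^ 2 - 1 = q ^ 2 + 4 * q + 3 := by
    rw [Nat.sub_eq_iff_eq_add (by nlinarith)]; ring
  have e2 : (2 + q) ^ (2 + 1) - 1 = (2 + q) * (q ^ 2 + 4 * q + 3) + (q + 1) := by
    rw [Nat.sub_eq_iff_eq_add (Nat.one_le_pow _ _ (by omega))]; ring
  rw [e1, e2, Nat.dvd_add_right (Dvd.intro_left _ rfl)] at this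
  have := Nat.le_of_dvd (by omega) this
  nlinarith

lemma PhiDvd.false_of_card_cube (h : PhiDvd P) (hP : Nat.card P = p ^ 3) (A : Subgroup P)
    (hA : Nat.card A = p ^ 2) (he : ∀ a ∈ A, a ^ p = 1) : False := by
  have hp2 := hp.out.two_le
  have hpg : IsPGroup p P := IsPGroup.of_card hP
  obtain ⟨g, hg⟩ := hpg.exists_orderOf_eq_exponent
  have hd := Group.exponent_dvd_nat_card (G := P)
  rw [hP, Nat.dvd_prime_pow hp.out] at hd
  obtain ⟨i, hi, hd⟩ := hd
  have hord : ∀ a ∈ A, orderOf a ≤ p := fun a ha =>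
    Nat.le_of_dvd hp.out.pos (orderOf_dvd_of_pow_eq_one (he a ha))
  have nA : Nontrivial A := Finite.one_lt_card_iff_nontrivial.1 (hA ▸ by nlinarith)
  have h2 : 2 ≤ i := by
    by_contra! hi2
    have := h.card_le_sq hP fun x => by
      have h1 : Monoid.exponent P ∣ p := by
        rw [hd]; exact (pow_dvd_pow p (by omega : i ≤ 1)).trans (by simp)
      exact Monoid.exponent_dvd_iff_forall_pow_eq_one.1 h1 x
    omega
  have h3 : i ≠ 3 := by
    rintro rfl
    have : IsCyclic P := isCyclic_of_orderOf_eq_card g (by rw [hg, hd, hP])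
    have h4 := IsCyclic.exponent_eq_card (α := A)
    rw [exponent_eq_of_forall_pow_prime hp.out fun x => Subtype.ext (he x x.2), hA] at h4
    nlinarith
  obtain rfl : i = 2 := by omega
  have d1 := h.dvd_phi A
  rw [phi_of_forall_pow_prime hp.out fun x => Subtype.ext (he x x.2), hA] at d1
  have d2 := h.totient_dvd g
  rw [hg, hd, Nat.totient_prime_pow hp.out (by norm_num)] at d2
  replace d2 : p ∣ phi P := by
    refine Dvd.dvd.trans ?_ d2
    simp
  have hle := phi_add_card_le A fun a ha => by
    have := hord a ha
    rw [hd]; nlinarith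
  rw [hA, hP] at hle
  have hpos := phi_pos hg
  have hc : Nat.Coprime (p ^ 2 - 1) p := by
    rw [Nat.coprime_comm, hp.out.coprime_iff_not_dvd]
    intro hh
    have h1 : p ∣ p ^ 2 := Dvd.intro_left (p ^ 1) rfl
    have := (Nat.dvd_sub_iff_right (by nlinarith) h1).1 hh
    exact hp.out.one_lt.ne' (Nat.dvd_one.1 this)
  have hm := Nat.le_of_dvd hpos (hc.mul_dvd_of_dvd_of_dvd d1 d2)
  obtain ⟨q, rfl⟩ := Nat.exists_eq_add_of_le hp2
  have e1 : (2 + q) ^ 2 - 1 = q ^ 2 + 4 * q + 3 := by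
    rw [Nat.sub_eq_iff_eq_add (by nlinarith)]; ring
  rw [e1] at hm
  nlinarith

lemma PhiDvd.false_of_elementary_subgroup (h : PhiDvd P) (hP : IsPGroup p P) {x : P}
    (hx : x ^ p ≠ 1) (A : Subgroup P) (hA : Nat.card A = p ^ 2) (he : ∀ a ∈ A, a ^ p = 1) :
    False := by
  obtain ⟨k, hk⟩ := IsPGroup.iff_card.1 hP
  have hdvd := Subgroup.card_subgroup_dvd_card A
  rw [hA, hk, Nat.pow_dvd_pow_iff_le_right hp.out.one_lt] at hdvd
  rcases hdvd.eq_or_lt with rfl | hlt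
  · have : A = ⊤ := Subgroup.eq_top_of_card_eq A (by rw [hA, hk])
    exact hx (he x (this ▸ Subgroup.mem_top x))
  · obtain ⟨K, hK, hAK⟩ := Sylow.exists_subgroup_card_pow_succ (G := P) (n := 2)
      (hk ▸ pow_dvd_pow p hlt) hA
    refine (h.subgroup K).false_of_card_cube hK (A.subgroupOf K) ?_ ?_
    · rw [← hA]
      exact Nat.card_congr (Subgroup.subgroupOfEquivOfLe hAK).toEquiv
    · intro a ha
      exact Subtype.ext (he a ha)

omit [Finite P] in
/-- Two commuting elements of order `p` in different cyclic subgroups generate a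
subgroup of order `p ^ 2` and exponent `p`. -/
lemma exists_elementary_subgroup {z x : P} (hzx : Commute z x) (hz : orderOf z = p)
    (hx : orderOf x = p) (hne : x ∉ Subgroup.zpowers z) :
    ∃ A : Subgroup P, Nat.card A = p ^ 2 ∧ ∀ a ∈ A, a ^ p = 1 := by
  have hcomm : ∀ (m : Subgroup.zpowers z) (n : Subgroup.zpowers x),
      Commute ((Subgroup.zpowers z).subtype m) ((Subgroup.zpowers x).subtype n) := by
    rintro ⟨_, i, rfl⟩ ⟨_, j, rfl⟩
    exact (hzx.zpow_zpow i j)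
  let f := MonoidHom.noncommCoprod _ _ hcomm
  have hdisj : Disjoint (Subgroup.zpowers z) (Subgroup.zpowers x) := by
    have hpx : IsPGroup p (Subgroup.zpowers z) :=
      IsPGroup.of_card (n := 1) (by rw [Nat.card_zpowers, hz, pow_one])
    have hpr : (Nat.card (Subgroup.zpowers x)).Prime := by
      rw [Nat.card_zpowers, hx]; exact hp.out
    have := Fact.mk hpr
    rcases Subgroup.eq_bot_or_eq_top_of_prime_card
      ((Subgroup.zpowers z).subgroupOf (Subgroup.zpowers x)) with h | h
    · exact Subgroup.subgroupOf_eq_bot.1 h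
    · exact absurd ((Subgroup.subgroupOf_eq_top.1 h) (Subgroup.mem_zpowers x)) hne
  have hinj : Function.Injective f := by
    rw [injective_iff_map_eq_one]
    rintro ⟨⟨a, ha⟩, ⟨b, hb⟩⟩ hab
    have hab' : a * b = 1 := hab
    have hb1 : a = b⁻¹ := eq_inv_of_mul_eq_one_left hab'
    have ha1 : a = 1 := Subgroup.disjoint_def.1 hdisj ha (hb1 ▸ inv_mem hb)
    subst ha1
    have : b = 1 := by simpa using hab'
    subst this
    rfl
  refine ⟨f.range, ?_, ?_⟩
  · rw [← Nat.card_congr (MonoidHom.ofInjective hinj).toEquiv, Nat.card_prod, Nat.card_zpowers,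
      Nat.card_zpowers, hz, hx, sq]
  · rintro _ ⟨⟨⟨_, i, rfl⟩, ⟨_, j, rfl⟩⟩, rfl⟩
    change (z ^ i * x ^ j) ^ p = 1
    rw [(hzx.zpow_zpow i j).mul_pow]
    simp only [← zpow_natCast, ← zpow_mul]
    rw [mul_comm i, mul_comm j, zpow_mul, zpow_mul, zpow_natCast, zpow_natCast,
      ← hz, pow_orderOf_eq_one, hz, ← hx, pow_orderOf_eq_one]
    simp

lemma PhiDvd.exists_unique_prime_subgroup (h : PhiDvd P) (hP : IsPGroup p P) {x : P}
    (hx : x ^ p ≠ 1) :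
    ∃ z : P, ∀ y : P, orderOf y = p → Subgroup.zpowers y = Subgroup.zpowers z := by
  have hnt : Nontrivial P := ⟨x, 1, fun h => hx (by rw [h, one_pow])⟩
  have hc := hP.center_nontrivial
  have hdvd : p ∣ Nat.card (Subgroup.center P) :=
    ((hP.to_subgroup _).card_eq_or_dvd).resolve_left (Finite.one_lt_card_iff_nontrivial.2 hc).ne'
  obtain ⟨⟨z, hz⟩, hzp⟩ := exists_prime_orderOf_dvd_card' p hdvd
  rw [Subgroup.orderOf_mk] at hzp
  refine ⟨z, fun y hy => ?_⟩
  have hle : Subgroup.zpowers y ≤ Subgroup.zpowers z := by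
    rw [Subgroup.zpowers_le]
    by_contra hyz
    obtain ⟨A, hA, he⟩ := exists_elementary_subgroup
      ((Subgroup.mem_center_iff.1 hz y).symm) hzp hy hyz
    exact h.false_of_elementary_subgroup hP hx A hA he
  exact Subgroup.eq_of_le_of_card_ge hle (by rw [Nat.card_zpowers, Nat.card_zpowers, hzp, hy])

end PGroup

section Quaternion

lemma exponent_quaternionGroup_two : Monoid.exponent (QuaternionGroup 2) = 4 := by
  rw [QuaternionGroup.exponent]; rfl

lemma quaternionGroup_two_orderOf_ne_four (a : QuaternionGroup 2) :
    orderOf a ≠ 4 ↔ a = 1 ∨ a = QuaternionGroup.a 2 := by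
  have h1 : a ^ 4 = 1 := by
    rw [← exponent_quaternionGroup_two]; exact Monoid.pow_exponent_eq_one a
  have h2 : a ^ 2 = 1 ↔ a = 1 ∨ a = QuaternionGroup.a 2 := by
    revert a; decide
  rw [← h2]
  constructor
  · intro h
    by_contra h3
    exact h (orderOf_eq_prime_pow (p := 2) (n := 1) h3 h1)
  · intro h h4
    have := orderOf_dvd_of_pow_eq_one h
    rw [h4] at this
    norm_num at this

lemma phi_quaternionGroup_two : phi (QuaternionGroup 2) = 6 := by
  rw [phi_eq_card_sub {1, QuaternionGroup.a 2}, Set.ncard_pair (by decide),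
    Nat.card_eq_fintype_card, QuaternionGroup.card]
  intro a
  rw [exponent_quaternionGroup_two, quaternionGroup_two_orderOf_ne_four]
  simp

/-- Two elements `x`, `y` satisfying the defining relations of the quaternion group of order 8. -/
lemma nonempty_mulEquiv_quaternionGroup {P : Type*} [Group P] [Finite P] (hP : Nat.card P = 8)
    {x y : P} (hx : orderOf x = 4) (hy : y ∉ Subgroup.zpowers x) (hyy : y ^ 2 = x ^ 2)
    (hxy : (x * y) ^ 2 = x ^ 2) : Nonempty (P ≃* QuaternionGroup 2) := by
  have hx4 : x ^ 4 = 1 := by rw [← hx, pow_orderOf_eq_one]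
  have hadd (i j : ZMod (2 * 2)) : x ^ (i + j).val = x ^ i.val * x ^ j.val := by
    rw [← pow_add, ZMod.val_add]
    exact pow_eq_pow_iff_modEq.2 (hx ▸ Nat.mod_modEq _ 4)
  have hconj1 : x * y = y * x⁻¹ := by
    have h1 : y * x * y = x := by
      have : x * (y * x * y) = x * x := by
        simpa only [sq, mul_assoc] using hxy
      exact mul_left_cancel this
    have h2 : y * x * y * y⁻¹ ^ 2 = x * y⁻¹ ^ 2 := by rw [h1]
    have h3 : y * x = x * y⁻¹ ^ 2 * y := by rw [← h2]; group
    have h5 : x * x = y * y := by simpa only [sq] using hyy.symm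
    rw [← mul_left_inj x, inv_mul_cancel_right, mul_assoc, h3]
    calc x * (x * y⁻¹ ^ 2 * y) = x * x * y⁻¹ := by group
      _ = y := by rw [h5]; group
  have hconj (k : ℕ) : x ^ k * y = y * (x ^ k)⁻¹ := by
    induction k with
    | zero => simp
    | succ k ih => rw [pow_succ, mul_assoc, hconj1, ← mul_assoc, ih]; group
  have hsub (i j : ZMod (2 * 2)) : x ^ (j - i).val = (x ^ i.val)⁻¹ * x ^ j.val := by
    rw [eq_inv_mul_iff_mul_eq, ← hadd]; simp
  let f : QuaternionGroup 2 →* P := MonoidHom.mk'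
    (fun g => match g with
      | .a i => x ^ i.val
      | .xa i => y * x ^ i.val) (by
    rintro (i | i) (j | j)
    · exact hadd i j
    · change y * x ^ (j - i).val = x ^ i.val * (y * x ^ j.val)
      rw [← mul_assoc, hconj, hsub, mul_assoc]
    · change y * x ^ (i + j).val = y * x ^ i.val * x ^ j.val
      rw [hadd, mul_assoc]
    · change x ^ (((2 : ℕ) : ZMod (2 * 2)) + j - i).val = y * x ^ i.val * (y * x ^ j.val)
      rw [mul_assoc, ← mul_assoc _ y, hconj, add_sub_assoc, hadd, hsub]
      have : x ^ ((2 : ℕ) : ZMod (2 * 2)).val = y * y := by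
        exact hyy.symm.trans (sq y)
      rw [this]; group)
  have hinj : Function.Injective f := by
    rw [injective_iff_map_eq_one]
    rintro (i | i) h
    · have h1 : x ^ i.val = 1 := h
      have h2 := orderOf_dvd_of_pow_eq_one h1
      rw [hx] at h2
      have h3 : i.val < 2 * 2 := ZMod.val_lt i
      have h4 : i.val = 0 := Nat.eq_zero_of_dvd_of_lt h2 h3
      rw [(ZMod.val_eq_zero i).1 h4]
      rfl
    · have h1 : y * x ^ i.val = 1 := h
      refine absurd ?_ hy
      rw [eq_inv_of_mul_eq_one_left h1]
      exact inv_mem (pow_mem (Subgroup.mem_zpowers x) _)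
  have hbij : Function.Bijective f := by
    have := Fintype.ofFinite P
    rw [Fintype.bijective_iff_injective_and_card]
    refine ⟨hinj, ?_⟩
    rw [QuaternionGroup.card, ← Nat.card_eq_fintype_card, hP]
  exact ⟨(MulEquiv.ofBijective f hbij).symm⟩

end Quaternion

lemma nonempty_linearEquiv_zmod_prod {V : Type*} [AddCommGroup V] {p : ℕ} [Fact p.Prime]
    [Module (ZMod p) V] (hV : Nat.card V = p ^ 2) :
    Nonempty (V ≃ₗ[ZMod p] ZMod p × ZMod p) := by
  have hfin : Finite V := Nat.finite_of_card_ne_zero (hV ▸ pow_ne_zero 2 (NeZero.ne p))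
  have : Module.Finite (ZMod p) V := Module.Finite.of_finite
  have hfr : Module.finrank (ZMod p) V = 2 := by
    have h1 := FiniteField.pow_finrank_eq_natCard p V
    exact Nat.pow_right_injective (Fact.out : p.Prime).two_le (h1.trans hV)
  have hfr' : Module.finrank (ZMod p) (ZMod p × ZMod p) = 2 := by simp
  exact ⟨LinearEquiv.ofFinrankEq V (ZMod p × ZMod p) (hfr.trans hfr'.symm)⟩

lemma AddCommGroup.nonempty_addEquiv_zmod_prod {V : Type*} [AddCommGroup V] {p : ℕ}
    [Fact p.Prime] (hV : Nat.card V = p ^ 2) (he : ∀ x : V, p • x = 0) :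
    Nonempty (V ≃+ ZMod p × ZMod p) := by
  let : Module (ZMod p) V := AddCommGroup.zmodModule he
  obtain ⟨e⟩ := nonempty_linearEquiv_zmod_prod hV
  exact ⟨e.toAddEquiv⟩

lemma CommGroup.nonempty_mulEquiv_zmod_prod {P : Type*} [CommGroup P] {p : ℕ} [Fact p.Prime]
    (hP : Nat.card P = p ^ 2) (he : ∀ x : P, x ^ p = 1) :
    Nonempty (P ≃* Multiplicative (ZMod p) × Multiplicative (ZMod p)) := by
  obtain ⟨e⟩ := AddCommGroup.nonempty_addEquiv_zmod_prod (V := Additive P) hP fun x => he x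
  exact ⟨(AddEquiv.toMultiplicativeRight e).trans (MulEquiv.prodMultiplicative _ _)⟩

lemma nonempty_mulEquiv_zmod_prod {P : Type*} [Group P] {p : ℕ} [Fact p.Prime]
    (hP : Nat.card P = p ^ 2) (he : ∀ x : P, x ^ p = 1) :
    Nonempty (P ≃* Multiplicative (ZMod p) × Multiplicative (ZMod p)) :=
  @CommGroup.nonempty_mulEquiv_zmod_prod P { ‹Group P› with
    mul_comm := (IsPGroup.isMulCommutative_of_card_eq_prime_sq hP).is_comm.comm } p _ hP he

lemma mul_pow_of_central_commutator {G : Type*} [Group G] {x u d : G} (h : u * x = x * u * d)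
    (hdx : Commute d x) (hdu : Commute d u) (m : ℕ) :
    (x * u) ^ m = x ^ m * u ^ m * d ^ m.choose 2 := by
  have h1 (k : ℕ) : u ^ k * x = x * u ^ k * d ^ k := by
    induction k with
    | zero => simp
    | succ k ih =>
      calc u ^ (k + 1) * x = u ^ k * (u * x) := by group
        _ = (u ^ k * x) * u * d := by rw [h]; group
        _ = x * u ^ k * (d ^ k * u) * d := by rw [ih]; group
        _ = _ := by rw [(hdu.pow_left k).eq]; group
  induction m with
  | zero => simp
  | succ m ih =>
    have h2 : (m + 1).choose 2 = m + m.choose 2 := by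
      rw [Nat.choose_succ_succ' m 1, Nat.choose_one_right]
    have h3 : Commute (d ^ m.choose 2) (x * u) := (hdx.mul_right hdu).pow_left _
    calc (x * u) ^ (m + 1) = x ^ m * u ^ m * (d ^ m.choose 2 * (x * u)) := by
          rw [pow_succ, ih]; group
      _ = x ^ m * (u ^ m * x) * u * d ^ m.choose 2 := by rw [h3.eq]; group
      _ = x ^ m * x * u ^ m * (d ^ m * u) * d ^ m.choose 2 := by rw [h1]; group
      _ = x ^ (m + 1) * u ^ (m + 1) * (d ^ m * d ^ m.choose 2) := by
          rw [(hdu.pow_left m).eq]; group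
      _ = _ := by rw [h2, pow_add d]

lemma orderOf_pow_of_not_dvd {P : Type*} [Group P] {p n : ℕ} [hp : Fact p.Prime] {v : P}
    (hv : orderOf v = p ^ n) {j : ℕ} (hj : ¬ p ∣ j) :
    orderOf (v ^ j) = p ^ n := by
  rw [← hv]
  refine Nat.Coprime.orderOf_pow ?_
  rw [hv]
  exact Nat.Coprime.pow_left n ((Nat.Prime.coprime_iff_not_dvd hp.out).2 hj)

lemma commute_of_mem_zpowers {P : Type*} [Group P] {x a b : P} (ha : a ∈ Subgroup.zpowers x)
    (hb : b ∈ Subgroup.zpowers x) : Commute a b := by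
  obtain ⟨i, rfl⟩ := ha
  obtain ⟨j, rfl⟩ := hb
  exact (Commute.refl x).zpow_zpow i j

lemma eq_of_zpowers_eq_of_orderOf_eq_two {G : Type*} [Group G] [Finite G] {a b : G}
    (ha : orderOf a = 2) (hb : orderOf b = 2)
    (h : Subgroup.zpowers a = Subgroup.zpowers b) : a = b := by
  classical
  have h1 : a ∈ Subgroup.zpowers b := h ▸ Subgroup.mem_zpowers a
  rw [mem_zpowers_iff_mem_range_orderOf, hb] at h1
  obtain ⟨i, hi, rfl⟩ := Finset.mem_image.1 h1
  rw [Finset.mem_range] at hi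
  interval_cases i
  · simp at ha
  · exact pow_one b

section MinimalNoncyclic

variable {P : Type*} [Group P] [Finite P] {p n : ℕ} [hp : Fact p.Prime]

/-- In a noncyclic `p`-group all of whose proper subgroups are cyclic, every element lies in a
cyclic subgroup of index `p`. -/
lemma exists_mem_zpowers_orderOf (hP : Nat.card P = p ^ (n + 1)) (hnc : ¬ IsCyclic P)
    (hM : ∀ M : Subgroup P, M ≠ ⊤ → IsCyclic M) (w : P) :
    ∃ v : P, orderOf v = p ^ n ∧ w ∈ Subgroup.zpowers v := by
  obtain ⟨m, hm, hwm⟩ := (Nat.dvd_prime_pow hp.out).1 (hP ▸ orderOf_dvd_natCard w)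
  have hmn : m ≤ n := by
    by_contra! h
    obtain rfl : m = n + 1 := by omega
    exact hnc (isCyclic_of_orderOf_eq_card w (hwm.trans hP.symm))
  obtain ⟨M, hMc, hwM⟩ := Sylow.exists_subgroup_card_pow_prime_le p
    (hP ▸ pow_dvd_pow p (Nat.le_succ n)) (Subgroup.zpowers w) ((Nat.card_zpowers w).trans hwm) hmn
  have hMt : M ≠ ⊤ := by
    rintro rfl
    rw [Subgroup.card_top, hP] at hMc
    have := Nat.pow_right_injective hp.out.two_le hMc
    omega
  obtain ⟨v, hv⟩ := (Subgroup.isCyclic_iff_exists_zpowers_eq_top M).1 (hM M hMt)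
  refine ⟨v, ?_, hv ▸ hwM (Subgroup.mem_zpowers w)⟩
  rw [← Nat.card_zpowers, hv, hMc]

omit [Finite P] in
lemma zpowers_normal_of_orderOf (hP : Nat.card P = p ^ (n + 1)) {v : P} (hv : orderOf v = p ^ n) :
    (Subgroup.zpowers v).Normal ∧ (Subgroup.zpowers v).index = p := by
  have hi : (Subgroup.zpowers v).index = p := by
    have := (Subgroup.zpowers v).card_mul_index
    rw [Nat.card_zpowers, hv, hP, pow_succ] at this
    exact Nat.eq_of_mul_eq_mul_left (pow_pos hp.out.pos n) this
  refine ⟨Subgroup.normal_of_index_eq_minFac_card ?_, hi⟩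
  rw [hi, hP, Nat.pow_minFac (Nat.succ_ne_zero n), hp.out.minFac_eq]

lemma orderOf_of_notMem_zpowers (hP : Nat.card P = p ^ (n + 1)) (hnc : ¬ IsCyclic P)
    (hM : ∀ M : Subgroup P, M ≠ ⊤ → IsCyclic M) {y w : P} (hy : orderOf y = p ^ n)
    (hw : w ∉ Subgroup.zpowers y) : orderOf w = p ^ n := by
  obtain ⟨v, hv, hwv⟩ := exists_mem_zpowers_orderOf hP hnc hM w
  obtain ⟨j, rfl⟩ := mem_powers_iff_mem_zpowers.2 hwv
  refine orderOf_pow_of_not_dvd hv fun ⟨k, hk⟩ => hw ?_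
  obtain ⟨hN, hi⟩ := zpowers_normal_of_orderOf hP hy
  have := Subgroup.pow_index_mem (Subgroup.zpowers y) v
  rw [hi] at this
  simp only [hk, pow_mul]
  exact pow_mem this k

/-- A minimal noncyclic `p`-group of order greater than `p ^ 2` has order 8, and is covered
by cyclic subgroups of order 4. -/
lemma eq_two_of_forall_isCyclic (hP : Nat.card P = p ^ (n + 1)) (hnc : ¬ IsCyclic P) (hn : 2 ≤ n)
    (hM : ∀ M : Subgroup P, M ≠ ⊤ → IsCyclic M) :
    p = 2 ∧ n = 2 ∧ ∃ x y : P, orderOf x = p ^ n ∧ orderOf y = p ^ n ∧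
      y ∉ Subgroup.zpowers x ∧ orderOf (x * y) = p ^ n := by
  obtain ⟨x, hx, -⟩ := exists_mem_zpowers_orderOf hP hnc hM 1
  obtain ⟨hNx, hix⟩ := zpowers_normal_of_orderOf hP hx
  obtain ⟨w, hw⟩ : ∃ w, w ∉ Subgroup.zpowers x := by
    by_contra! h
    exact hnc ⟨x, h⟩
  have hy := orderOf_of_notMem_zpowers hP hnc hM hx hw
  obtain ⟨y, hyw⟩ : ∃ y, y = w := ⟨w, rfl⟩
  rw [← hyw] at hw hy
  have hxy : x ∉ Subgroup.zpowers y := by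
    intro h
    have h1 : Subgroup.zpowers x ≤ Subgroup.zpowers y := by rwa [Subgroup.zpowers_le]
    have h2 := Subgroup.eq_of_le_of_card_ge h1 (by rw [Nat.card_zpowers, Nat.card_zpowers, hx, hy])
    exact hw (h2 ▸ Subgroup.mem_zpowers y)
  obtain ⟨hNy, hiy⟩ := zpowers_normal_of_orderOf hP hy
  have hxyo : orderOf (x * y) = p ^ n := by
    refine orderOf_of_notMem_zpowers hP hnc hM hx fun h => hw ?_
    exact (Subgroup.mul_mem_cancel_left _ (Subgroup.mem_zpowers x)).1 h
  have hxp : x ^ p ∈ Subgroup.zpowers y := hiy ▸ Subgroup.pow_index_mem (Subgroup.zpowers y) x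
  obtain ⟨j, hj⟩ := mem_powers_iff_mem_zpowers.2 hxp
  change y ^ j = x ^ p at hj
  have hpj : p ∣ j := by
    by_contra h
    have h1 := orderOf_pow_of_not_dvd hy h
    rw [hj, orderOf_pow, hx, Nat.gcd_eq_right (dvd_pow_self p (by omega))] at h1
    have h2 : p ^ n / p < p ^ n := Nat.div_lt_self (pow_pos hp.out.pos n) hp.out.one_lt
    omega
  obtain ⟨k, rfl⟩ := hpj
  set u := (y ^ k)⁻¹ with hu
  have huy : u ∈ Subgroup.zpowers y := inv_mem (pow_mem (Subgroup.mem_zpowers y) k)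
  have hup : u ^ p = (x ^ p)⁻¹ := by rw [hu, inv_pow, ← pow_mul, mul_comm, hj]
  set d := u⁻¹ * x⁻¹ * u * x with hd
  have hdx : d ∈ Subgroup.zpowers x := by
    refine mul_mem ?_ (Subgroup.mem_zpowers x)
    simpa using hNx.conj_mem x⁻¹ (inv_mem (Subgroup.mem_zpowers x)) u⁻¹
  have hdy : d ∈ Subgroup.zpowers y := by
    have := hNy.conj_mem u huy x⁻¹
    rw [inv_inv] at this
    rw [hd, mul_assoc, mul_assoc]
    exact mul_mem (inv_mem huy) (by rwa [← mul_assoc])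
  have hcx : Commute d x := commute_of_mem_zpowers hdx (Subgroup.mem_zpowers x)
  have hcu : Commute d u := commute_of_mem_zpowers hdy huy
  have hux : u * x = x * u * d := by rw [hd]; group
  have hdp : d ^ p = 1 := by
    have h1 : x⁻¹ * u * x = u * d := by rw [hd]; group
    have h2 : (x⁻¹ * u * x⁻¹⁻¹) ^ p = x⁻¹ * u ^ p * x⁻¹⁻¹ := conj_pow
    have h3 : x⁻¹ * u ^ p * x = u ^ p := by rw [hup]; group
    rw [inv_inv, h3, h1, hcu.symm.mul_pow] at h2
    exact mul_eq_left.1 h2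
  have hxup : (x * u) ^ p = d ^ p.choose 2 := by
    rw [mul_pow_of_central_commutator hux hcx hcu, hup, mul_inv_cancel, one_mul]
  have hxuo : orderOf (x * u) = p ^ n := by
    refine orderOf_of_notMem_zpowers hP hnc hM hy fun h => hxy ?_
    exact (Subgroup.mul_mem_cancel_right _ huy).1 h
  have hp2 : p = 2 := by
    by_contra hp2
    have h1 : (x * u) ^ p = 1 := by
      obtain ⟨c, hc⟩ := hp.out.dvd_choose_self two_ne_zero
        (lt_of_le_of_ne hp.out.two_le (Ne.symm hp2))
      rw [hxup, hc, pow_mul, hdp, one_pow]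
    have h2 := orderOf_dvd_of_pow_eq_one h1
    rw [hxuo] at h2
    have h3 := Nat.pow_dvd_pow_iff_le_right hp.out.one_lt |>.1 (h2.trans (pow_one p).symm.dvd)
    omega
  have hn2 : n = 2 := by
    have h1 : (x * u) ^ p ^ 2 = 1 := by
      rw [sq, pow_mul, hxup, ← pow_mul, mul_comm, pow_mul, hdp, one_pow]
    have h2 := orderOf_dvd_of_pow_eq_one h1
    rw [hxuo] at h2
    have h3 := Nat.pow_dvd_pow_iff_le_right hp.out.one_lt |>.1 h2
    omega
  exact ⟨hp2, hn2, x, y, hx, hy, hw, hxyo⟩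

/-- A noncyclic `p`-group satisfying `PhiDvd`, of exponent other than `p` and with all proper
subgroups cyclic, is the quaternion group of order 8. -/
lemma PhiDvd.nonempty_mulEquiv_quaternionGroup (h : PhiDvd P) (hP : IsPGroup p P) {x₀ : P}
    (hx₀ : x₀ ^ p ≠ 1) (hnc : ¬ IsCyclic P) (hM : ∀ M : Subgroup P, M ≠ ⊤ → IsCyclic M) :
    Nat.card P = 8 ∧ Nonempty (P ≃* QuaternionGroup 2) := by
  obtain ⟨m, hm⟩ := IsPGroup.iff_card.1 hP
  obtain ⟨n, rfl⟩ : ∃ n, m = n + 1 := by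
    refine Nat.exists_eq_succ_of_ne_zero ?_
    rintro rfl
    have := (Nat.card_eq_one_iff_unique.1 (by simpa using hm)).1
    exact hnc inferInstance
  have hn : 2 ≤ n := by
    by_contra! hn
    obtain rfl | rfl : n = 0 ∨ n = 1 := by omega
    · exact hnc (isCyclic_of_prime_card (hm.trans (pow_one p)))
    · refine hx₀ ?_
      rw [← (not_isCyclic_iff_exponent_eq_prime hp.out hm).1 hnc]
      exact Monoid.pow_exponent_eq_one x₀
  obtain ⟨rfl, rfl, x, y, hx, hy, hyx, hxy⟩ := eq_two_of_forall_isCyclic hm hnc hn hM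
  obtain ⟨z, hz⟩ := h.exists_unique_prime_subgroup hP hx₀
  have hsq {a : P} (ha : orderOf a = 2 ^ 2) : orderOf (a ^ 2) = 2 := by
    rw [orderOf_pow, ha]
    rfl
  have heq {a b : P} (ha : orderOf a = 2 ^ 2) (hb : orderOf b = 2 ^ 2) : a ^ 2 = b ^ 2 :=
    eq_of_zpowers_eq_of_orderOf_eq_two (hsq ha) (hsq hb)
      ((hz _ (hsq ha)).trans (hz _ (hsq hb)).symm)
  exact ⟨hm, nonempty_mulEquiv_quaternionGroup hm hx hyx (heq hy hx) (heq hxy hx)⟩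

end MinimalNoncyclic

section Classification

lemma PhiDvd.false_of_quaternion_subgroup {P : Type*} [Group P] [Finite P] (h : PhiDvd P)
    (hP : IsPGroup 2 P) (M : Subgroup P) (hMt : M ≠ ⊤) (e : M ≃* QuaternionGroup 2) : False := by
  have hMexp : Monoid.exponent M = 4 := by
    rw [Monoid.exponent_eq_of_mulEquiv e, exponent_quaternionGroup_two]
  have hMphi : phi M = 6 := by rw [phi_congr e, phi_quaternionGroup_two]
  have hMcard : Nat.card M = 2 ^ 3 := by
    rw [Nat.card_congr e.toEquiv, Nat.card_eq_fintype_card, QuaternionGroup.card]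
    norm_num
  obtain ⟨m, hm⟩ := IsPGroup.iff_card.1 hP
  have h16 : 2 ^ (3 + 1) ∣ Nat.card P := by
    have h1 := M.card_subgroup_dvd_card
    rw [hMcard, hm, Nat.pow_dvd_pow_iff_le_right (by norm_num)] at h1
    rw [hm]
    refine pow_dvd_pow 2 (Nat.lt_of_le_of_ne h1 ?_)
    rintro rfl
    exact hMt (Subgroup.eq_top_of_card_eq M (hMcard.trans hm.symm))
  obtain ⟨K, hK, hMK⟩ := Sylow.exists_subgroup_card_pow_succ h16 hMcard
  have h6 : 6 ∣ phi K := hMphi ▸ h M K hMK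
  have hMK' : Nat.card (M.subgroupOf K) = 8 := by
    rw [Nat.card_congr (Subgroup.subgroupOfEquivOfLe hMK).toEquiv, hMcard]
    norm_num
  have hMx (a : K) (ha : a ∈ M.subgroupOf K) : orderOf a ∣ 4 := by
    rw [← Subgroup.orderOf_coe, ← hMexp]
    exact orderOf_dvd_of_pow_eq_one
      (congrArg Subtype.val (Monoid.pow_exponent_eq_one (⟨a, ha⟩ : M)))
  have hKp : IsPGroup 2 K := hP.to_subgroup K
  obtain ⟨g, hg⟩ := hKp.exists_orderOf_eq_exponent
  have hpos : 0 < phi K := phi_pos hg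
  have h4 : 4 ∣ Monoid.exponent K := by
    rw [← hMexp]
    exact Monoid.exponent_dvd_of_monoidHom (Subgroup.inclusion hMK)
      (Subgroup.inclusion_injective hMK)
  obtain ⟨j, hj, hgj⟩ := (Nat.dvd_prime_pow Nat.prime_two).1 (hK ▸ orderOf_dvd_natCard g)
  have hj2 : 2 ≤ j := by
    rw [← hg, hgj] at h4
    exact (Nat.pow_dvd_pow_iff_le_right (x := 2) (by norm_num)).1 h4
  have hMnc : ¬ IsCyclic M := by
    intro hc
    have := IsCyclic.exponent_eq_card (α := M)
    rw [hMexp, hMcard] at this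
    norm_num at this
  obtain rfl | rfl | rfl : j = 2 ∨ j = 3 ∨ j = 4 := by omega
  · have hx0 : (g : P) ^ 2 ≠ 1 := by
      intro h0
      have := orderOf_dvd_of_pow_eq_one h0
      rw [Subgroup.orderOf_coe, hgj] at this
      norm_num at this
    obtain ⟨z, hz⟩ := h.exists_unique_prime_subgroup hP hx0
    have hgo : orderOf (g ^ 2) = 2 := by
      rw [orderOf_pow, hgj]
      rfl
    have hg2 : g ^ 2 ≠ 1 := fun h0 => by simp [h0] at hgo
    have hphi : phi K = 14 := by
      rw [phi_eq_card_sub {1, g ^ 2}, Set.ncard_pair hg2.symm, hK]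
      · norm_num
      intro a
      have ha4 : a ^ 2 ^ 2 = 1 := by
        rw [← hgj, hg]
        exact Monoid.pow_exponent_eq_one a
      rw [← hg, hgj, Set.mem_insert_iff, Set.mem_singleton_iff]
      constructor
      · rintro (rfl | rfl)
        · simp
        · rw [hgo]; norm_num
      · intro ha
        have ha2 : a ^ 2 = 1 := by
          by_contra h2
          exact ha (orderOf_eq_prime_pow (n := 1) (by simpa using h2) ha4)
        by_cases ha1 : a = 1
        · exact Or.inl ha1
        · right
          have hao := orderOf_eq_prime ha2 ha1
          refine Subtype.ext (eq_of_zpowers_eq_of_orderOf_eq_two ?_ ?_ ?_)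
          · rwa [Subgroup.orderOf_coe]
          · rwa [Subgroup.orderOf_coe]
          · rw [hz a (by rwa [Subgroup.orderOf_coe]),
              hz ((g ^ 2 : K) : P) (by rwa [Subgroup.orderOf_coe])]
    rw [hphi] at h6
    norm_num at h6
  · have h1 : 4 ∣ phi K := by
      have := (h.subgroup K).totient_dvd g
      rw [hgj, Nat.totient_prime_pow_succ Nat.prime_two] at this
      exact this
    have h2 := phi_add_card_le (M.subgroupOf K) (by
      intro a ha h8
      have := hMx a ha
      rw [h8, ← hg, hgj] at this
      norm_num at this)
    rw [hMK', hK] at h2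
    have h12 : phi K ≤ 8 := by norm_num at h2; omega
    omega
  · have hKc : IsCyclic K := isCyclic_of_orderOf_eq_card g (hgj.trans hK.symm)
    exact hMnc (isCyclic_of_injective (Subgroup.inclusion hMK) (Subgroup.inclusion_injective hMK))

/-- Classification of the finite `p`-groups satisfying `PhiDvd`. -/
theorem PhiDvd.pGroup_classification {P : Type*} [Group P] [Finite P] {p : ℕ} [hp : Fact p.Prime]
    (h : PhiDvd P) (hP : IsPGroup p P) :
    IsCyclic P ∨ (Nat.card P = 8 ∧ Nonempty (P ≃* QuaternionGroup 2)) ∨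
      (Nat.card P = p ^ 2 ∧ ∀ x : P, x ^ p = 1) := by
  induction hn : Nat.card P using Nat.strong_induction_on generalizing P with
  | _ n ih =>
  subst hn
  by_cases he : ∀ x : P, x ^ p = 1
  · obtain ⟨k, hk⟩ := IsPGroup.iff_card.1 hP
    have hk2 := h.card_le_sq hk he
    obtain hk1 | rfl : k ≤ 1 ∨ k = 2 := by omega
    · left
      refine isCyclic_of_card_dvd_prime (p := p) ?_
      rw [hk]
      exact (pow_dvd_pow p hk1).trans (pow_one p).dvd
    · exact Or.inr (Or.inr ⟨hk, he⟩)
  push Not at he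
  obtain ⟨x, hx⟩ := he
  refine or_iff_not_imp_left.2 fun hnc => Or.inl (h.nonempty_mulEquiv_quaternionGroup hP hx hnc ?_)
  intro M hM
  have hlt : Nat.card M < Nat.card P :=
    lt_of_le_of_ne M.card_le_card_group fun h0 => hM (Subgroup.eq_top_of_card_eq M h0)
  obtain hc | ⟨h8, ⟨e⟩⟩ | ⟨hsq, hMe⟩ := ih _ hlt (h.subgroup M) (hP.to_subgroup M) rfl
  · exact hc
  · have hp2 : p = 2 := by
      obtain ⟨k, hk⟩ := IsPGroup.iff_card.1 (hP.to_subgroup M)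
      have h2 : 2 ∣ p ^ k := by rw [← hk, h8]; norm_num
      exact ((Nat.prime_dvd_prime_iff_eq Nat.prime_two hp.out).1
        (Nat.prime_two.dvd_of_dvd_pow h2)).symm
    subst hp2
    exact (h.false_of_quaternion_subgroup hP M hM e).elim
  · refine (h.false_of_elementary_subgroup hP hx M hsq fun a ha => ?_).elim
    exact congrArg Subtype.val (hMe ⟨a, ha⟩)

end Classification

section Nilpotent

open Subgroup

variable {G : Type*} [Group G] [Finite G]

lemma commute_of_coprime_orderOf [Group.IsNilpotent G] {a b : G}
    (hab : (orderOf a).Coprime (orderOf b)) : Commute a b := by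
  obtain ⟨e⟩ := (Group.isNilpotent_of_finite_tfae (G := G)).out 0 4 |>.1 ‹_›
  have key (a : G) (p : (Nat.card G).primeFactors) (P : Sylow p G) (hpa : ¬ (p : ℕ) ∣ orderOf a) :
      e.symm a p P = 1 := by
    have hp : Fact (p : ℕ).Prime := ⟨Nat.prime_of_mem_primeFactors p.2⟩
    have h1 : e.symm a p P ^ orderOf a = 1 := by
      have : e.symm a ^ orderOf a = 1 := by rw [← map_pow, pow_orderOf_eq_one, map_one]
      rw [← Pi.pow_apply, ← Pi.pow_apply, this]
      rfl
    obtain ⟨k, hk⟩ := IsPGroup.iff_orderOf.1 P.isPGroup' (e.symm a p P)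
    have h2 := orderOf_dvd_of_pow_eq_one h1
    rw [hk] at h2
    rw [← orderOf_eq_one_iff, hk]
    by_contra h3
    exact hpa ((dvd_pow_self _ fun h4 => h3 (by rw [h4, pow_zero])).trans h2)
  have : Commute (e.symm a) (e.symm b) := by
    refine funext fun p => funext fun P => ?_
    change e.symm a p P * e.symm b p P = e.symm b p P * e.symm a p P
    by_cases hpa : (p : ℕ) ∣ orderOf a
    · rw [key b p P fun hpb => ?_, one_mul, mul_one]
      exact (Nat.prime_of_mem_primeFactors p.2).not_dvd_one (hab ▸ Nat.dvd_gcd hpa hpb)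
    · rw [key a p P hpa, one_mul, mul_one]
  simpa using this.map e

omit [Finite G] in
lemma commute_of_commute_commutator {y z : G} (hc : Commute (z⁻¹ * (y * z * y⁻¹)) y)
    (ho : (orderOf (z⁻¹ * (y * z * y⁻¹))).Coprime (orderOf y)) : Commute y z := by
  set d := z⁻¹ * (y * z * y⁻¹) with hd
  have h1 (m : ℕ) : y ^ m * z * (y ^ m)⁻¹ = z * d ^ m := by
    induction m with
    | zero => simp
    | succ m ih =>
      have h2 : y * z * y⁻¹ = z * d := by rw [hd]; group
      have h3 : y * d ^ m * y⁻¹ = d ^ m := by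
        rw [← (hc.pow_left m).eq, mul_inv_cancel_right]
      calc y ^ (m + 1) * z * (y ^ (m + 1))⁻¹ = y * (y ^ m * z * (y ^ m)⁻¹) * y⁻¹ := by
            rw [pow_succ']; group
        _ = (y * z * y⁻¹) * (y * d ^ m * y⁻¹) := by rw [ih]; group
        _ = _ := by rw [h2, h3, pow_succ', mul_assoc]
  have h4 : d ^ orderOf y = 1 := by
    have := h1 (orderOf y)
    rw [pow_orderOf_eq_one] at this
    simpa using this
  have h5 : d = 1 := by
    rw [← orderOf_eq_one_iff]
    exact Nat.eq_one_of_dvd_coprimes ho dvd_rfl (orderOf_dvd_of_pow_eq_one h4)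
  have := h1 1
  rw [h5, one_pow, mul_one, pow_one] at this
  exact mul_inv_eq_iff_eq_mul.1 this

lemma commute_of_mem_of_ne_top (hnil : ∀ M : Subgroup G, M ≠ ⊤ → Group.IsNilpotent M)
    {M : Subgroup G} (hM : M ≠ ⊤) {a b : G} (ha : a ∈ M) (hb : b ∈ M)
    (hab : (orderOf a).Coprime (orderOf b)) : Commute a b := by
  have := hnil M hM
  have h : Commute (⟨a, ha⟩ : M) ⟨b, hb⟩ :=
    commute_of_coprime_orderOf (by rwa [Subgroup.orderOf_mk, Subgroup.orderOf_mk])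
  exact h.map M.subtype

omit [Finite G] in
lemma isNilpotent_of_sup_eq_top (A B : Subgroup G) (hA : Group.IsNilpotent A)
    (hB : Group.IsNilpotent B) (hc : ∀ a ∈ A, ∀ b ∈ B, Commute a b) (hs : A ⊔ B = ⊤) :
    Group.IsNilpotent G := by
  have hcomm : ∀ (m : A) (n : B), Commute (A.subtype m) (B.subtype n) :=
    fun m n => hc m m.2 n n.2
  have hf : Function.Surjective (A.subtype.noncommCoprod B.subtype hcomm) := by
    rw [← MonoidHom.range_eq_top, MonoidHom.noncommCoprod_range, A.range_subtype,
      B.range_subtype, hs]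
  exact Group.nilpotent_of_surjective _ hf

omit [Finite G] in
lemma mem_of_pow_mem_of_coprime (H : Subgroup G) {g : G} {m n : ℕ} (hm : g ^ m ∈ H)
    (hn : g ^ n ∈ H) (hmn : m.Coprime n) : g ∈ H := by
  have h := Nat.gcd_eq_gcd_ab m n
  rw [hmn.gcd_eq_one] at h
  have h1 : g = (g ^ m) ^ m.gcdA n * (g ^ n) ^ m.gcdB n := by
    rw [← zpow_natCast g m, ← zpow_natCast g n, ← zpow_mul, ← zpow_mul, ← zpow_add, ← h]
    simp
  rw [h1]
  exact mul_mem (zpow_mem hm _) (zpow_mem hn _)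

omit [Finite G] in
lemma IsPGroup.coprime_orderOf {p : ℕ} [Fact p.Prime] {P : Subgroup G} (hP : IsPGroup p P)
    {z b : G} (hz : z ∈ P) (hb : p.Coprime (orderOf b)) : (orderOf z).Coprime (orderOf b) := by
  obtain ⟨k, hk⟩ := IsPGroup.iff_orderOf.1 hP ⟨z, hz⟩
  rw [Subgroup.orderOf_mk] at hk
  rw [hk]
  exact Nat.Coprime.pow_left k hb

omit [Finite G] in
lemma mem_of_orderOf_eq_pow {p : ℕ} (P : Sylow p G) {x : G} {k : ℕ}
    (hx : orderOf x = p ^ k) (hxn : x ∈ normalizer (P : Set G)) : x ∈ P := by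
  have h1 : IsPGroup p (zpowers x) := IsPGroup.of_card ((Nat.card_zpowers x).trans hx)
  have h2 := h1.inf_normalizer_sylow P
  have h3 : x ∈ zpowers x ⊓ normalizer (P : Set G) := ⟨mem_zpowers x, hxn⟩
  rw [h2] at h3
  exact h3.2

end Nilpotent

section NormalSylow

open Subgroup

variable {G : Type*} [Group G] [Finite G]

/-- An element of order prime to `p` which centralizes a nontrivial element of a normal
abelian Sylow `p`-subgroup centralizes the whole Sylow subgroup, provided all proper
subgroups are nilpotent. -/
lemma commute_of_normal_abelian_sylow (hnil : ∀ M : Subgroup G, M ≠ ⊤ → Group.IsNilpotent M)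
    {p : ℕ} [hp : Fact p.Prime] (P : Sylow p G) [hPn : P.Normal]
    (hab : ∀ x ∈ P, ∀ y ∈ P, Commute x y) {b c z : G} (hb : p.Coprime (orderOf b))
    (hc : c ∈ P) (hc1 : c ≠ 1) (hcb : Commute c b) (hz : z ∈ P) : Commute b z := by
  have hconj {g : G} (x : P) : g * x * g⁻¹ ∈ P := hPn.conj_mem x x.2 g
  let f : P →* P := MonoidHom.mk' (fun x => x⁻¹ * ⟨b * x * b⁻¹, hconj x⟩) (by
    intro x y
    apply Subtype.ext
    have h1 : ((y : G)⁻¹) * (x : G)⁻¹ = (x : G)⁻¹ * (y : G)⁻¹ :=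
      hab _ (inv_mem y.2) _ (inv_mem x.2)
    have h2 : (y : G)⁻¹ * (b * x * b⁻¹) = b * x * b⁻¹ * (y : G)⁻¹ :=
      hab _ (inv_mem y.2) _ (hconj x)
    calc ((x : G) * y)⁻¹ * (b * (x * y) * b⁻¹)
        = ((y : G)⁻¹ * (x : G)⁻¹) * (b * x * b⁻¹) * (b * y * b⁻¹) := by group
      _ = (x : G)⁻¹ * ((y : G)⁻¹ * (b * x * b⁻¹)) * (b * y * b⁻¹) := by rw [h1]; group
      _ = (x : G)⁻¹ * (b * x * b⁻¹) * ((y : G)⁻¹ * (b * y * b⁻¹)) := by rw [h2]; group)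
  have hfval (x : P) : (f x : G) = (x : G)⁻¹ * (b * x * b⁻¹) := rfl
  set D : Subgroup G := f.range.map (P : Subgroup G).subtype with hD
  have hmemD (g : G) : g ∈ D ↔ ∃ x : P, (x : G)⁻¹ * (b * x * b⁻¹) = g := by
    rw [hD, Subgroup.mem_map]
    constructor
    · rintro ⟨-, ⟨x, rfl⟩, rfl⟩
      exact ⟨x, rfl⟩
    · rintro ⟨x, rfl⟩
      exact ⟨f x, ⟨x, rfl⟩, rfl⟩
  have hDP : D ≤ P := Subgroup.map_subtype_le _
  have hDne : D ≠ P := by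
    intro h
    have hsurj : Function.Surjective f := by
      intro y
      have hy : (y : G) ∈ D := by rw [h]; exact y.2
      obtain ⟨x, hx⟩ := (hmemD _).1 hy
      exact ⟨x, Subtype.ext hx⟩
    have hinj : Function.Injective f := Finite.injective_iff_surjective.2 hsurj
    have hfc : f ⟨c, hc⟩ = f 1 := by
      rw [map_one]
      apply Subtype.ext
      rw [hfval]
      change c⁻¹ * (b * c * b⁻¹) = 1
      rw [← hcb.eq, mul_inv_cancel_right, inv_mul_cancel]
    exact hc1 (congrArg Subtype.val (hinj hfc))
  have hbD : b ∈ normalizer (D : Set G) := by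
    rw [mem_normalizer_iff]
    intro h
    rw [hmemD, hmemD]
    constructor
    · rintro ⟨x, rfl⟩
      exact ⟨⟨b * x * b⁻¹, hconj x⟩, by group⟩
    · rintro ⟨x, hx⟩
      have hx' : b⁻¹ * x * b ∈ P := by
        have := hPn.conj_mem x x.2 b⁻¹
        rwa [inv_inv] at this
      refine ⟨⟨b⁻¹ * x * b, hx'⟩, ?_⟩
      have : h = b⁻¹ * (b * h * b⁻¹) * b := by group
      rw [this, ← hx]
      group
  have hM : D ⊔ zpowers b ≠ ⊤ := by
    intro htop
    have hDn : D.Normal := by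
      rw [← normalizer_eq_top_iff, eq_top_iff, ← htop]
      exact sup_le le_normalizer (by rwa [zpowers_le])
    have h1 : D.index ∣ orderOf b := by
      rw [← relIndex_top_right, ← htop, relIndex_sup_left, ← Nat.card_zpowers]
      exact relIndex_dvd_card ..
    obtain ⟨k, hk⟩ := IsPGroup.iff_card.1 P.isPGroup'
    have h2 : (Nat.card P).Coprime D.index := by
      rw [hk]
      exact (Nat.Coprime.pow_left k hb).coprime_dvd_right h1
    have h3 : Nat.card P ∣ Nat.card D := by
      refine h2.dvd_of_dvd_mul_right ?_
      rw [card_mul_index]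
      exact card_subgroup_dvd_card _
    exact hDne (eq_of_le_of_card_ge hDP (Nat.le_of_dvd Nat.card_pos h3))
  have hdD : z⁻¹ * (b * z * b⁻¹) ∈ D := (hmemD _).2 ⟨⟨z, hz⟩, rfl⟩
  have hcop := P.isPGroup'.coprime_orderOf (hDP hdD) hb
  exact commute_of_commute_commutator (commute_of_mem_of_ne_top hnil hM
    (mem_sup_left hdD) (mem_sup_right (mem_zpowers b)) hcop) hcop

omit [Finite G] in
/-- An element of order prime to `p` centralizing an index two cyclic subgroup of a
normal Sylow `p`-subgroup centralizes the Sylow subgroup. -/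
lemma commute_of_normal_sylow_of_index_two {p : ℕ} [Fact p.Prime] (P : Sylow p G)
    [hPn : P.Normal] {b z : G} (hb : p.Coprime (orderOf b)) {c : P} (hc : (zpowers c).index = 2)
    (hcb : Commute (c : G) b) (hz : z ∈ P) : Commute b z := by
  have hbz : b * z * b⁻¹ ∈ P := hPn.conj_mem z hz b
  have hcomm {x : P} (hx : x ∈ zpowers c) : Commute (x : G) b := by
    obtain ⟨i, rfl⟩ := hx
    exact hcb.zpow_left i
  have hiff : (⟨z, hz⟩ : P) ∈ zpowers c ↔ (⟨b * z * b⁻¹, hbz⟩ : P) ∈ zpowers c := by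
    constructor
    · intro h
      have h1 : b * z * b⁻¹ = z := by
        rw [← (hcomm h).eq, mul_inv_cancel_right]
      simpa only [h1] using h
    · intro h
      have h1 : b * z * b⁻¹ = z := by
        have h2 : b * z * b⁻¹ * b = b * (b * z * b⁻¹) := (hcomm h).eq
        rw [inv_mul_cancel_right] at h2
        exact (mul_left_cancel h2).symm
      simpa only [h1] using h
  have hd : (⟨z, hz⟩ : P)⁻¹ * ⟨b * z * b⁻¹, hbz⟩ ∈ zpowers c := by
    rw [mul_mem_iff_of_index_two hc, inv_mem_iff]
    exact hiff
  refine commute_of_commute_commutator (hcomm hd) ?_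
  exact P.isPGroup'.coprime_orderOf (mul_mem (inv_mem hz) hbz) hb

/-- If all proper subgroups of `G` are nilpotent and `G` is the product of a normal Sylow
`p`-subgroup and a cyclic group, then `PhiDvd` and `phi G ≠ 0` force `G` to be nilpotent. -/
lemma isNilpotent_of_normal_sylow_sup_zpowers (h : PhiDvd G) (hphi : phi G ≠ 0)
    (hnil : ∀ M : Subgroup G, M ≠ ⊤ → Group.IsNilpotent M)
    {p : ℕ} [hp : Fact p.Prime] (P : Sylow p G) [hPn : P.Normal] (hP1 : (P : Subgroup G) ≠ ⊥)
    {k : G} (hk : (P : Subgroup G) ⊔ zpowers k = ⊤) : Group.IsNilpotent G := by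
  obtain ⟨⟨a, ha⟩⟩ : Nonempty {a : G // orderOf a = Monoid.exponent G} := by
    by_contra hempty
    rw [not_nonempty_iff] at hempty
    exact hphi Nat.card_of_isEmpty
  have hE : orderOf a ≠ 0 := (orderOf_pos a).ne'
  obtain ⟨r, m, hpm, hrm⟩ := Nat.exists_eq_pow_mul_and_not_dvd hE p hp.out.ne_one
  have hcop : p.Coprime m := (Nat.Prime.coprime_iff_not_dvd hp.out).2 hpm
  have hm0 : m ≠ 0 := by
    rintro rfl
    exact hpm (dvd_zero p)
  have hc : orderOf (a ^ m) = p ^ r := by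
    rw [orderOf_pow_of_dvd hm0 ⟨p ^ r, by rw [hrm, mul_comm]⟩, hrm,
      Nat.mul_div_cancel _ (Nat.pos_of_ne_zero hm0)]
  have hb : orderOf (a ^ p ^ r) = m := by
    rw [orderOf_pow_of_dvd (pow_pos hp.out.pos r).ne' ⟨m, hrm⟩, hrm,
      Nat.mul_div_cancel_left _ (pow_pos hp.out.pos r)]
  have hcb : Commute (a ^ m) (a ^ p ^ r) := (Commute.refl a).pow_pow _ _
  set b := a ^ p ^ r with hbdef
  have hbc : p.Coprime (orderOf b) := hb ▸ hcop
  have hcP : a ^ m ∈ P := mem_of_orderOf_eq_pow P hc (by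
    have := (normalizer_eq_top_iff (H := (P : Subgroup G))).2 hPn
    rw [← P.coe_coe, this]
    exact mem_top _)
  have hPE : Monoid.exponent P ∣ p ^ r := by
    obtain ⟨t, ht⟩ := isPGroup_iff_exponent_eq_pow.1 P.isPGroup'
    have h1 : Monoid.exponent P ∣ p ^ r * m := by
      rw [← hrm, ha]
      exact Monoid.exponent_dvd_of_monoidHom (P : Subgroup G).subtype (subtype_injective _)
    refine Nat.Coprime.dvd_of_dvd_mul_right ?_ h1
    rw [ht]
    exact Nat.Coprime.pow_left t hcop
  have hcE : orderOf (⟨a ^ m, hcP⟩ : P) = Monoid.exponent P := by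
    refine Nat.dvd_antisymm (Monoid.order_dvd_exponent _) ?_
    rwa [Subgroup.orderOf_mk, hc]
  have hPnt : Nontrivial P := (Subgroup.nontrivial_iff_ne_bot _).2 hP1
  have hc1 : a ^ m ≠ 1 := by
    intro h1
    rw [Subgroup.orderOf_mk, h1, orderOf_one] at hcE
    exact Monoid.exp_eq_one_iff.1 hcE.symm |> not_subsingleton_iff_nontrivial.2 hPnt
  have hPb : (P : Subgroup G) ⊔ zpowers b = ⊤ := by
    have h1 : P.index ∣ orderOf k := by
      rw [← relIndex_top_right, ← hk, relIndex_sup_left, ← Nat.card_zpowers]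
      exact relIndex_dvd_card ..
    have h2 : P.index ∣ m := by
      have h3 : P.index ∣ p ^ r * m := by
        rw [← hrm, ha]
        exact h1.trans (Monoid.order_dvd_exponent k)
      refine Nat.Coprime.dvd_of_dvd_mul_left ?_ h3
      exact (Nat.Coprime.pow_left r ((Nat.Prime.coprime_iff_not_dvd hp.out).2 P.not_dvd_index)).symm
    have h4 : Nat.card P * m ∣ Nat.card ((P : Subgroup G) ⊔ zpowers b : Subgroup G) := by
      refine Nat.Coprime.mul_dvd_of_dvd_of_dvd ?_ (card_dvd_of_le le_sup_left) ?_
      · obtain ⟨t, ht⟩ := IsPGroup.iff_card.1 P.isPGroup'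
        rw [ht]
        exact Nat.Coprime.pow_left t hcop
      · have := card_dvd_of_le (le_sup_right : zpowers b ≤ (P : Subgroup G) ⊔ zpowers b)
        rwa [Nat.card_zpowers, hb] at this
    refine eq_top_of_card_eq _ (Nat.dvd_antisymm (card_subgroup_dvd_card _) ?_)
    rw [← (P : Subgroup G).card_mul_index]
    exact (mul_dvd_mul_left _ h2).trans h4
  have hmain : ∀ z ∈ P, Commute b z := by
    intro z hz
    have habel (hab : ∀ x y : P, x * y = y * x) : Commute b z :=
      commute_of_normal_abelian_sylow hnil P
        (fun x hx y hy => congrArg Subtype.val (hab ⟨x, hx⟩ ⟨y, hy⟩)) hbc hcP hc1 hcb hz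
    obtain hcyc | ⟨h8, ⟨e⟩⟩ | ⟨hsq, -⟩ := (h.subgroup P).pGroup_classification P.isPGroup'
    · exact habel hcyc.isMulCommutative.is_comm.comm
    · refine commute_of_normal_sylow_of_index_two P hbc (c := ⟨a ^ m, hcP⟩) ?_ hcb hz
      have h1 := (zpowers (⟨a ^ m, hcP⟩ : P)).card_mul_index
      rw [Nat.card_zpowers, hcE, Monoid.exponent_eq_of_mulEquiv e, exponent_quaternionGroup_two]
        at h1
      have h2 := h1.trans h8
      omega
    · exact habel (IsPGroup.isMulCommutative_of_card_eq_prime_sq hsq).is_comm.comm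
  refine isNilpotent_of_sup_eq_top (P : Subgroup G) (zpowers b) P.isPGroup'.isNilpotent
    (@CommGroup.isNilpotent _ IsCyclic.commGroup) ?_ hPb
  rintro x hx - ⟨i, rfl⟩
  exact ((hmain x hx).zpow_left i).symm

/-- If all proper subgroups of `G` are nilpotent and some nontrivial Sylow subgroup is normal,
then `PhiDvd` and `phi G ≠ 0` force `G` to be nilpotent. -/
lemma isNilpotent_of_normal_sylow (h : PhiDvd G) (hphi : phi G ≠ 0)
    (hnil : ∀ M : Subgroup G, M ≠ ⊤ → Group.IsNilpotent M)
    {p : ℕ} [hp : Fact p.Prime] (P : Sylow p G) [hPn : P.Normal]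
    (hP1 : (P : Subgroup G) ≠ ⊥) : Group.IsNilpotent G := by
  obtain ⟨K, hK⟩ := exists_right_complement'_of_coprime P.card_coprime_index
  by_cases hk : ∃ k ∈ K, (P : Subgroup G) ⊔ zpowers k = ⊤
  · obtain ⟨k, -, hk⟩ := hk
    exact isNilpotent_of_normal_sylow_sup_zpowers h hphi hnil P hP1 hk
  push Not at hk
  have hKt : K ≠ ⊤ := by
    rintro rfl
    exact hP1 (isComplement'_top_right.1 hK)
  refine isNilpotent_of_sup_eq_top (P : Subgroup G) K P.isPGroup'.isNilpotent (hnil K hKt) ?_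
    hK.sup_eq_top
  intro x hx k hkK
  refine commute_of_mem_of_ne_top hnil (hk k hkK) (mem_sup_left hx)
    (mem_sup_right (mem_zpowers k)) (P.isPGroup'.coprime_orderOf hx ?_)
  rw [Nat.Prime.coprime_iff_not_dvd hp.out]
  intro hdvd
  apply P.not_dvd_index
  rw [hK.symm.index_eq_card]
  refine hdvd.trans ?_
  rw [← Nat.card_zpowers]
  exact card_dvd_of_le (by rwa [zpowers_le])

end NormalSylow

section Nilpotency

open Subgroup

variable {G : Type*} [Group G] [Finite G]

/-- An abelian Sylow `p`-subgroup with nilpotent normalizer is central in its normalizer. -/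
lemma normalizer_le_centralizer_of_isNilpotent {p : ℕ} [hp : Fact p.Prime] (P : Sylow p G)
    (hab : ∀ x ∈ P, ∀ y ∈ P, Commute x y)
    (hN : Group.IsNilpotent (normalizer (P : Set G))) :
    normalizer (P : Set G) ≤ centralizer (P : Set G) := by
  intro g hg
  rw [mem_centralizer_iff]
  intro z hz
  obtain ⟨r, m, hpm, hrm⟩ := Nat.exists_eq_pow_mul_and_not_dvd (orderOf_pos g).ne' p hp.out.ne_one
  have hcop : p.Coprime m := (Nat.Prime.coprime_iff_not_dvd hp.out).2 hpm
  have hm0 : m ≠ 0 := by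
    rintro rfl
    exact hpm (dvd_zero p)
  have hgm : orderOf (g ^ m) = p ^ r := by
    rw [orderOf_pow_of_dvd hm0 ⟨p ^ r, by rw [hrm, mul_comm]⟩, hrm,
      Nat.mul_div_cancel _ (Nat.pos_of_ne_zero hm0)]
  have hgr : orderOf (g ^ p ^ r) = m := by
    rw [orderOf_pow_of_dvd (pow_pos hp.out.pos r).ne' ⟨m, hrm⟩, hrm,
      Nat.mul_div_cancel_left _ (pow_pos hp.out.pos r)]
  have h1 : g ^ m ∈ centralizer {z} := by
    rw [mem_centralizer_singleton_iff]
    exact hab _ (mem_of_orderOf_eq_pow P hgm (pow_mem hg m)) _ hz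
  have h2 : g ^ p ^ r ∈ centralizer {z} := by
    rw [mem_centralizer_singleton_iff]
    have hzN : z ∈ normalizer (P : Set G) := le_normalizer (H := (P : Subgroup G)) hz
    have hcomm : Commute (⟨g ^ p ^ r, pow_mem hg _⟩ : normalizer (P : Set G)) ⟨z, hzN⟩ := by
      refine commute_of_coprime_orderOf ?_
      rw [Subgroup.orderOf_mk, Subgroup.orderOf_mk]
      exact (P.isPGroup'.coprime_orderOf hz (by rwa [hgr])).symm
    exact congrArg Subtype.val hcomm.eq
  have h3 := mem_of_pow_mem_of_coprime _ h1 h2 (Nat.Coprime.pow_left r hcop).symm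
  exact (mem_centralizer_singleton_iff.1 h3).symm

omit [Finite G] in
lemma PhiDvd.commute_of_mem_sylow (h : PhiDvd G) {p : ℕ} [hp : Fact p.Prime] (hp2 : p ≠ 2)
    (P : Sylow p G) [Finite P] : ∀ x ∈ P, ∀ y ∈ P, Commute x y := by
  have hmul : ∀ x y : P, x * y = y * x := by
    obtain hcyc | ⟨h8, -⟩ | ⟨hsq, -⟩ := (h.subgroup P).pGroup_classification P.isPGroup'
    · exact hcyc.isMulCommutative.is_comm.comm
    · obtain ⟨t, ht⟩ := IsPGroup.iff_card.1 P.isPGroup'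
      have h2 : 2 ∣ p ^ t := by rw [← ht, h8]; norm_num
      exact absurd ((Nat.prime_dvd_prime_iff_eq Nat.prime_two hp.out).1
        (Nat.prime_two.dvd_of_dvd_pow h2)).symm hp2
    · exact (IsPGroup.isMulCommutative_of_card_eq_prime_sq hsq).is_comm.comm
  exact fun x hx y hy => congrArg Subtype.val (hmul ⟨x, hx⟩ ⟨y, hy⟩)

/-- A Sylow subgroup of a nilpotent normal subgroup of index prime to `q` is a normal Sylow
subgroup of the whole group. -/
lemma exists_normal_sylow_of_normal (N : Subgroup G) [N.Normal] [Group.IsNilpotent N] {q : ℕ}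
    [hq : Fact q.Prime] (hqN : q ∣ Nat.card N) (hqi : ¬ q ∣ N.index) :
    ∃ Q : Sylow q G, (Q : Subgroup G).Normal ∧ (Q : Subgroup G) ≠ ⊥ := by
  let Q₀ : Sylow q N := default
  have hchar : (Q₀ : Subgroup N).Characteristic := Q₀.characteristic_of_normal inferInstance
  have hcard : Nat.card ((Q₀ : Subgroup N).map N.subtype) = q ^ (Nat.card G).factorization q := by
    rw [Nat.card_congr ((Q₀ : Subgroup N).equivMapOfInjective _ N.subtype_injective).symm.toEquiv]
    refine Q₀.card_eq_multiplicity.trans ?_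
    rw [← N.card_mul_index, Nat.factorization_mul Nat.card_pos.ne' N.index_ne_zero_of_finite,
      Finsupp.add_apply, Nat.factorization_eq_zero_of_not_dvd hqi, add_zero]
  refine ⟨Sylow.ofCard _ hcard, ?_, ?_⟩
  · change ((Q₀ : Subgroup N).map N.subtype).Normal
    infer_instance
  · exact Sylow.ne_bot_of_dvd_card _ (hqN.trans (card_subgroup_dvd_card N))

/-- `PhiDvd` together with nonvanishing of `phi` on all subgroups implies nilpotency. -/
theorem PhiDvd.isNilpotent (h : PhiDvd G) (hne : ∀ S : Subgroup G, phi S ≠ 0) :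
    Group.IsNilpotent G := by
  induction hn : Nat.card G using Nat.strong_induction_on generalizing G with
  | _ n ih =>
  subst hn
  have hnil : ∀ M : Subgroup G, M ≠ ⊤ → Group.IsNilpotent M := by
    intro M hM
    refine ih _ (lt_of_le_of_ne M.card_le_card_group fun h0 => hM (eq_top_of_card_eq M h0))
      (h.subgroup M) (fun S => ?_) rfl
    rw [← phi_map_subtype]
    exact hne _
  have hphi : phi G ≠ 0 := by
    rw [← phi_congr (topEquiv (G := G))]
    exact hne ⊤
  by_cases h2 : ∀ p : ℕ, p.Prime → p ∣ Nat.card G → p = 2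
  · have h3 := Nat.eq_prime_pow_of_unique_prime_dvd Nat.card_pos.ne' fun {d} hd hdG => h2 d hd hdG
    have : Fact (Nat.Prime 2) := ⟨Nat.prime_two⟩
    exact (IsPGroup.of_card h3).isNilpotent
  push Not at h2
  obtain ⟨p, hp, hpG, hp2⟩ := h2
  have hpf : Fact p.Prime := ⟨hp⟩
  let P : Sylow p G := default
  have hP1 : (P : Subgroup G) ≠ ⊥ := P.ne_bot_of_dvd_card hpG
  by_cases hPn : (P : Subgroup G).Normal
  · exact isNilpotent_of_normal_sylow h hphi hnil P hP1
  have hN : normalizer (P : Set G) ≠ ⊤ := fun h0 =>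
    hPn ((normalizer_eq_top_iff (H := (P : Subgroup G))).1 h0)
  have hPc := normalizer_le_centralizer_of_isNilpotent P (h.commute_of_mem_sylow hp2 P)
    (hnil _ hN)
  have hcompl := MonoidHom.ker_transferSylow_isComplement' P hPc
  have hpN := MonoidHom.not_dvd_card_ker_transferSylow P hPc
  set N := (MonoidHom.transferSylow P hPc).ker with hNdef
  have hNt : N ≠ ⊤ := by
    intro h0
    rw [h0] at hcompl
    exact hP1 (isComplement'_top_left.1 hcompl)
  have := hnil N hNt
  by_cases hN1 : Nat.card N = 1
  · have hPt : (P : Subgroup G) = ⊤ := by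
      rw [eq_bot_of_card_eq N hN1] at hcompl
      exact isComplement'_bot_left.1 hcompl
    exact absurd (hPt ▸ inferInstance) hPn
  obtain ⟨q, hq, hqN⟩ := Nat.exists_prime_and_dvd hN1
  have hqf : Fact q.Prime := ⟨hq⟩
  obtain ⟨Q, hQn, hQ1⟩ := exists_normal_sylow_of_normal N hqN (by
    rw [hcompl.symm.index_eq_card]
    intro hqP
    obtain ⟨t, ht⟩ := IsPGroup.iff_card.1 P.isPGroup'
    have h3 := (Nat.prime_dvd_prime_iff_eq hq hp).1 (hq.dvd_of_dvd_pow (ht ▸ hqP))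
    exact hpN (h3 ▸ hqN))
  exact isNilpotent_of_normal_sylow h hphi hnil Q hQ1

end Nilpotency

section Converse

open Subgroup

variable {G : Type*} [Group G]

lemma phi_pi {ι : Type*} [Fintype ι] {M : ι → Type*} [∀ i, Group (M i)] [∀ i, Finite (M i)]
    (hM : Pairwise fun i j => (Nat.card (M i)).Coprime (Nat.card (M j))) :
    phi (∀ i, M i) = ∏ i, phi (M i) := by
  classical
  have key (x : ∀ i, M i) : orderOf x = Monoid.exponent (∀ i, M i) ↔
      ∀ i, orderOf (x i) = Monoid.exponent (M i) := by
    rw [Pi.orderOf, Monoid.exponent_pi]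
    refine ⟨fun h i => Nat.dvd_antisymm (Monoid.order_dvd_exponent _) ?_, fun h => ?_⟩
    · have h1 : Monoid.exponent (M i) ∣
          orderOf (x i) * ∏ j ∈ Finset.univ.erase i, Nat.card (M j) := by
        refine (Finset.dvd_lcm (Finset.mem_univ i)).trans (h ▸ Finset.lcm_dvd fun j _ => ?_)
        by_cases hij : j = i
        · subst hij
          exact dvd_mul_right _ _
        · have hj : j ∈ Finset.univ.erase i := Finset.mem_erase.2 ⟨hij, Finset.mem_univ j⟩
          exact ((orderOf_dvd_natCard (x j)).trans
            (Finset.dvd_prod_of_mem (fun j => Nat.card (M j)) hj)).trans (dvd_mul_left _ _)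
      refine Nat.Coprime.dvd_of_dvd_mul_right (Nat.Coprime.prod_right fun j hj => ?_) h1
      exact (hM (Finset.ne_of_mem_erase hj).symm).coprime_dvd_left Group.exponent_dvd_nat_card
    · exact Finset.lcm_congr rfl fun i _ => h i
  unfold phi
  rw [← Nat.card_pi]
  exact Nat.card_congr ((Equiv.subtypeEquivRight key).trans (Equiv.subtypePiEquivPi
    (p := fun i (a : M i) => orderOf a = Monoid.exponent (M i))))

lemma phi_eq_prod_sylow [Finite G] [Group.IsNilpotent G] (P : ∀ p, Sylow p G) :
    phi G = ∏ p ∈ (Nat.card G).primeFactors, phi (P p) := by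
  obtain ⟨e⟩ := (Group.isNilpotent_of_finite_tfae (G := G)).out 0 4 |>.1 ‹_›
  have hp (p : (Nat.card G).primeFactors) : Fact (p : ℕ).Prime :=
    ⟨Nat.prime_of_mem_primeFactors p.2⟩
  let u (p : (Nat.card G).primeFactors) : Unique (Sylow p G) :=
    Sylow.unique_of_normal (P p) inferInstance
  let e' : (∀ p : (Nat.card G).primeFactors, P p) ≃* G :=
    (MulEquiv.piCongrRight fun p =>
      (MulEquiv.piUnique fun Q : Sylow p G => (Q : Subgroup G)).trans
        (MulEquiv.subgroupCongr (congrArg _ (Subsingleton.elim _ _)))).symm.trans e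
  rw [← phi_congr e', phi_pi]
  · exact Finset.prod_coe_sort _ fun p => phi (P p)
  intro p q hpq
  exact IsPGroup.coprime_card_of_ne p q (Subtype.coe_ne_coe.2 hpq) _ _ (P p).isPGroup'
    (P q).isPGroup'

lemma PhiDvd.congr {H : Type*} [Group H] (e : G ≃* H) (h : PhiDvd H) : PhiDvd G := by
  intro A B hAB
  rw [phi_congr (A.equivMapOfInjective e.toMonoidHom e.injective),
    phi_congr (B.equivMapOfInjective e.toMonoidHom e.injective)]
  exact h _ _ (Subgroup.map_mono hAB)

lemma phiDvd_of_isCyclic [Finite G] [IsCyclic G] : PhiDvd G := by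
  intro A B hAB
  rw [phi_of_isCyclic, phi_of_isCyclic]
  exact Nat.totient_dvd_of_dvd (card_dvd_of_le hAB)

lemma phiDvd_quaternionGroup_two : PhiDvd (QuaternionGroup 2) := by
  have hc : Nat.card (QuaternionGroup 2) = 2 ^ 3 := by simp [QuaternionGroup.card]
  have key (H : Subgroup (QuaternionGroup 2)) (hH : H ≠ ⊤) : IsCyclic H ∧ Nat.card H ∣ 2 ^ 2 := by
    obtain ⟨k, hk3, hk⟩ := (Nat.dvd_prime_pow Nat.prime_two).1 (hc ▸ card_subgroup_dvd_card H)
    have hk2 : k ≤ 2 := by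
      by_contra! h
      exact hH ((card_eq_iff_eq_top H).1 (by rw [hk, hc, (by omega : k = 3)]))
    refine ⟨?_, hk ▸ pow_dvd_pow 2 hk2⟩
    by_cases h4 : ∃ x : H, orderOf x = 4
    · obtain ⟨x, hx⟩ := h4
      refine isCyclic_of_orderOf_eq_card x (Nat.dvd_antisymm (orderOf_dvd_natCard x) ?_)
      rw [hx, hk]
      exact pow_dvd_pow 2 hk2
    · have hsub : (H : Set (QuaternionGroup 2)) ⊆ {1, .a 2} := fun x hx =>
        (quaternionGroup_two_orderOf_ne_four x).1 fun h => h4 ⟨⟨x, hx⟩, by rw [orderOf_mk, h]⟩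
      have hle : Nat.card H ≤ 2 :=
        (Set.ncard_le_ncard hsub (Set.toFinite _)).trans ((Set.ncard_insert_le _ _).trans (by simp))
      obtain h | h : Nat.card H = 1 ∨ Nat.card H = 2 := by
        have := Nat.card_pos (α := H)
        omega
      · have := (Nat.card_eq_one_iff_unique.1 h).1
        infer_instance
      · exact isCyclic_of_prime_card (p := 2) h
  intro A B hAB
  by_cases hB : B = ⊤
  · subst hB
    rw [phi_congr (topEquiv (G := QuaternionGroup 2))]
    by_cases hA : A = ⊤
    · rw [hA, phi_congr topEquiv]
    · obtain ⟨_, h⟩ := key A hA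
      rw [phi_of_isCyclic, phi_quaternionGroup_two]
      exact (Nat.totient_dvd_of_dvd h).trans (by decide)
  · have hA : A ≠ ⊤ := fun hA => hB (top_le_iff.1 (hA ▸ hAB))
    have := (key A hA).1
    have := (key B hB).1
    rw [phi_of_isCyclic, phi_of_isCyclic]
    exact Nat.totient_dvd_of_dvd (card_dvd_of_le hAB)

lemma phiDvd_of_card_sq [Finite G] {p : ℕ} [hp : Fact p.Prime] (hc : Nat.card G = p ^ 2)
    (hG : ∀ x : G, x ^ p = 1) : PhiDvd G := by
  have key (H : Subgroup G) (hH : H ≠ ⊥) : phi H = Nat.card H - 1 := by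
    have := (nontrivial_iff_ne_bot H).2 hH
    exact phi_of_forall_pow_prime hp.out fun x => Subtype.ext (hG x)
  intro A B hAB
  by_cases hA : A = ⊥
  · subst hA
    simp [phi_of_isCyclic]
  have hB : B ≠ ⊥ := fun hB => hA (le_bot_iff.1 (hB ▸ hAB))
  rw [key A hA, key B hB]
  obtain ⟨j, hj2, hj⟩ := (Nat.dvd_prime_pow hp.out).1 (hc ▸ card_subgroup_dvd_card B)
  obtain ⟨i, hij, hi⟩ := (Nat.dvd_prime_pow hp.out).1 (hj ▸ card_dvd_of_le hAB)
  have hi0 : i ≠ 0 := fun h => hA (eq_bot_of_card_eq A (by rw [hi, h, pow_zero]))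
  rw [hi, hj]
  refine Nat.pow_sub_one_dvd_pow_sub_one p ?_
  interval_cases j <;> interval_cases i <;> simp_all

lemma PhiDvd.of_sylow [Finite G] [Group.IsNilpotent G]
    (h : ∀ (p : ℕ) (_ : Fact p.Prime) (P : Sylow p G), PhiDvd P) : PhiDvd G := by
  intro H K hHK
  let PH : ∀ p, Sylow p H := fun _ => default
  let PK : ∀ p, Sylow p K := fun _ => default
  rw [phi_eq_prod_sylow PH, phi_eq_prod_sylow PK]
  refine (Finset.prod_dvd_prod_of_dvd _ _ fun p hp => ?_).trans
    (Finset.prod_dvd_prod_of_subset _ _ _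
      (Nat.primeFactors_mono (card_dvd_of_le hHK) Nat.card_pos.ne'))
  have : Fact p.Prime := ⟨Nat.prime_of_mem_primeFactors hp⟩
  obtain ⟨P, hP⟩ := ((PK p).isPGroup'.map K.subtype).exists_le_sylow
  obtain ⟨Q, hQ⟩ := ((PH p).isPGroup'.map (inclusion hHK)).exists_le_sylow
  let u := Sylow.unique_of_normal (PK p) inferInstance
  have hAB : ((PH p : Subgroup H).map H.subtype) ≤ (PK p : Subgroup K).map K.subtype := by
    rw [Subsingleton.elim (PK p) Q]
    refine le_trans (le_of_eq ?_) (map_mono hQ)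
    rw [map_map, subtype_comp_inclusion]
  rw [← phi_map_subtype H, ← phi_map_subtype K,
    ← phi_congr (subgroupOfEquivOfLe hP), ← phi_congr (subgroupOfEquivOfLe (hAB.trans hP))]
  exact h p ‹_› P _ _ (comap_mono hAB)

end Converse

theorem stmt_0 (G : Type*) [Group G] [Finite G]
    (hne : ∀ S : Subgroup G, phi S ≠ 0) :
    (∀ H K : Subgroup G, H ≤ K → phi H ∣ phi K) ↔
      (Group.IsNilpotent G ∧
        ∀ (p : ℕ) (_ : Fact p.Prime) (P : Sylow p G),
          IsCyclic P ∨ Nonempty (P ≃* QuaternionGroup 2) ∨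
            Nonempty (P ≃* (Multiplicative (ZMod p) × Multiplicative (ZMod p)))) := by
  constructor
  · intro h
    refine ⟨PhiDvd.isNilpotent h hne, fun p _ P => ?_⟩
    obtain hc | ⟨-, hq⟩ | ⟨hc, he⟩ :=
      (PhiDvd.subgroup h (P : Subgroup G)).pGroup_classification P.isPGroup'
    · exact Or.inl hc
    · exact Or.inr (Or.inl hq)
    · exact Or.inr (Or.inr (nonempty_mulEquiv_zmod_prod hc he))
  · rintro ⟨_, h⟩
    refine PhiDvd.of_sylow fun p hp P => ?_
    obtain hc | ⟨⟨e⟩⟩ | ⟨⟨e⟩⟩ := h p hp P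
    · exact phiDvd_of_isCyclic
    · exact phiDvd_quaternionGroup_two.congr e
    · refine PhiDvd.congr e (phiDvd_of_card_sq (p := p) ?_ fun x => ?_)
      · simp [sq]
      · have hz (y : Multiplicative (ZMod p)) : y ^ p = 1 := by
          simpa using pow_card_eq_one' (x := y)
        exact Prod.ext (hz x.1) (hz x.2)
end

section
/- Let p be a prime and let G be a finite p-group such that for all subgroups H, K of G with H ⊆ K, φ(H) divides φ(K). Then G is cyclic, isomorphic to the quaternion group Q₈, or isomorphic to ℤ_p × ℤ_p. -/
open Subgroup
open scoped commutatorElement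

theorem exists_monoidHom_zmod {G : Type*} [Group G] (x : G) {n : ℕ} (hx : orderOf x = n) :
    ∃ f : Multiplicative (ZMod n) →* G, Function.Injective f ∧ f.range = zpowers x ∧
      f (Multiplicative.ofAdd 1) = x := by
  have hgen : ∀ y : zpowers x, y ∈ zpowers (⟨x, mem_zpowers x⟩ : zpowers x) := by
    rintro ⟨_, k, rfl⟩
    exact ⟨k, Subtype.ext (by simp)⟩
  let e := zmodMulEquivOfGenerator hgen ((Nat.card_zpowers x).trans hx)
  refine ⟨(zpowers x).subtype.comp e.toMonoidHom,
    (Subtype.val_injective).comp e.injective, ?_, ?_⟩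
  · rw [MonoidHom.range_comp, (MonoidHom.range_eq_top (f := e.toMonoidHom)).2 e.surjective,
      ← MonoidHom.range_eq_map, range_subtype]
  · simp [e]

theorem totient_dvd_card_orderOf_eq {G : Type*} [Group G] [Finite G] (n : ℕ) :
    n.totient ∣ Nat.card {x : G // orderOf x = n} := by
  classical
  have := Fintype.ofFinite G
  rw [Nat.card_eq_fintype_card, Fintype.card_subtype, Finset.card_eq_sum_card_image zpowers]
  refine Finset.dvd_sum fun C hC ↦ ?_
  obtain ⟨x, hx, rfl⟩ := Finset.mem_image.1 hC
  have hx' : orderOf x = n := (Finset.mem_filter.1 hx).2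
  have hcard : Fintype.card (zpowers x) = n := by
    rw [← Nat.card_eq_fintype_card, Nat.card_zpowers, hx']
  rw [← IsCyclic.card_orderOf_eq_totient hcard.symm.dvd, ← Finset.card_map (.subtype _)]
  refine dvd_of_eq (congrArg Finset.card (Finset.ext fun y ↦ ?_))
  simp only [Finset.mem_map, Finset.mem_filter, Finset.mem_univ, true_and,
    Function.Embedding.subtype_apply, Subtype.exists]
  constructor
  · rintro ⟨z, hz, hn, rfl⟩
    rw [orderOf_mk] at hn
    refine ⟨hn, eq_of_le_of_card_ge (zpowers_le.2 hz) ?_⟩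
    rw [Nat.card_zpowers, Nat.card_zpowers, hn, hx']
  · rintro ⟨hn, hz⟩
    exact ⟨y, hz ▸ mem_zpowers y, by rw [orderOf_mk, hn], rfl⟩

section PGroup

variable {p : ℕ} [Fact p.Prime] {G : Type*} [Group G] [Finite G]

theorem IsPGroup.phi_pos (hG : IsPGroup p G) : 0 < phi G := by
  obtain ⟨k, hk⟩ := hG.exists_exponent_eq_pow
  obtain ⟨g, hg⟩ := (Fact.out : p.Prime).exists_orderOf_eq_pow_factorization_exponent G
  have : Nonempty {a : G // orderOf a = Monoid.exponent G} :=
    ⟨g, by rw [hg, hk, (Fact.out : p.Prime).factorization_pow, Finsupp.single_eq_same]⟩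
  exact Nat.card_pos

theorem totient_exponent_dvd_phi (G : Type*) [Group G] [Finite G] :
    (Monoid.exponent G).totient ∣ phi G :=
  totient_dvd_card_orderOf_eq _

theorem phi_add_card_pow_eq_one {k : ℕ} (hk : Monoid.exponent G = p ^ (k + 1)) :
    phi G + Nat.card {x : G // x ^ p ^ k = 1} = Nat.card G := by
  classical
  have := Fintype.ofFinite G
  have key (x : G) : orderOf x = Monoid.exponent G ↔ ¬ x ^ p ^ k = 1 := by
    rw [hk]
    refine ⟨fun h h' ↦ ?_, fun h ↦ orderOf_eq_prime_pow h (hk ▸ Monoid.pow_exponent_eq_one x)⟩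
    have := Nat.le_of_dvd (pow_pos (Fact.out : p.Prime).pos _) (h ▸ orderOf_dvd_of_pow_eq_one h')
    exact absurd this (not_le.2 (Nat.pow_lt_pow_right (Fact.out : p.Prime).one_lt k.lt_succ_self))
  simp only [phi, key, Nat.card_eq_fintype_card]
  rw [Fintype.card_subtype_compl, Nat.sub_add_cancel (Fintype.card_subtype_le _)]

theorem phi_add_card_le_s3 {k : ℕ} (hk : Monoid.exponent G = p ^ (k + 1)) {H : Subgroup G}
    (hH : ∀ x ∈ H, x ^ p ^ k = 1) : phi G + Nat.card H ≤ Nat.card G := by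
  rw [← phi_add_card_pow_eq_one hk]
  gcongr
  exact Nat.card_le_card_of_injective (fun x : H ↦ (⟨x, hH x x.2⟩ : {x : G // x ^ p ^ k = 1}))
    fun x y h ↦ Subtype.ext (congrArg (fun z ↦ z.1) h)

theorem phi_add_one_eq_card (hG : Monoid.exponent G = p) : phi G + 1 = Nat.card G := by
  have h := phi_add_card_pow_eq_one (p := p) (k := 0) (G := G) (by simpa using hG)
  simpa using h

end PGroup

theorem IsPGroup.exists_le_card_mul {p : ℕ} [Fact p.Prime] {G : Type*} [Group G] [Finite G]
    (hG : IsPGroup p G) {H : Subgroup G} (hH : H ≠ ⊤) :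
    ∃ K : Subgroup G, H ≤ K ∧ Nat.card K = Nat.card H * p := by
  obtain ⟨n, hn⟩ := IsPGroup.iff_card.1 hG
  obtain ⟨m, hm⟩ := IsPGroup.iff_card.1 (hG.to_subgroup H)
  have hp : p.Prime := Fact.out
  have hlt : m < n := by
    have h1 : Nat.card H < Nat.card G :=
      lt_of_le_of_ne (card_le_card_group H) fun h ↦ hH (eq_top_of_card_eq H h)
    rw [hn, hm] at h1
    exact (Nat.pow_lt_pow_iff_right hp.one_lt).1 h1
  obtain ⟨K, hK, hle⟩ :=
    Sylow.exists_subgroup_card_pow_succ (p := p) (n := m) (hn ▸ pow_dvd_pow p hlt) hm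
  exact ⟨K, hle, by rw [hK, hm, pow_succ]⟩

/-- An elementary abelian subgroup of rank two must be the whole group. -/
theorem eq_top_of_exponent_prime_of_card_sq {p : ℕ} [Fact p.Prime] {G : Type*} [Group G]
    [Finite G] (hG : IsPGroup p G) (hdvd : ∀ H K : Subgroup G, H ≤ K → phi H ∣ phi K)
    {H : Subgroup G} (hexp : Monoid.exponent H = p) (hcard : Nat.card H = p ^ 2) : H = ⊤ := by
  by_contra hH
  obtain ⟨K, hHK, hK⟩ := hG.exists_le_card_mul hH
  have hp : p.Prime := Fact.out
  have h2 := hp.two_le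
  have hphi := phi_add_one_eq_card hexp
  have hd := hdvd H K hHK
  have hKp := hG.to_subgroup K
  have hpos := hKp.phi_pos
  obtain ⟨k, hk⟩ := hKp.exists_exponent_eq_pow
  rw [hcard] at hphi hK
  obtain ⟨m, hm⟩ := hd
  obtain ⟨q, rfl⟩ : ∃ q, p = q + 2 := ⟨p - 2, by omega⟩
  match k, hk with
  | 0, hk =>
    rw [pow_zero, Monoid.exp_eq_one_iff] at hk
    rw [Nat.card_of_subsingleton (1 : K)] at hK
    nlinarith
  | 1, hk =>
    have := phi_add_one_eq_card (hk.trans (pow_one _))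
    rw [hK] at this
    obtain h | h : m ≤ q + 2 ∨ q + 3 ≤ m := by omega
    · nlinarith
    · nlinarith
  | k + 2, hk =>
    have hle := phi_add_card_le_s3 hk (H := H.subgroupOf K) fun x hx ↦ by
      have h1 : (⟨x, hx⟩ : H) ^ (q + 2) = 1 := by
        conv_lhs => rw [← hexp]
        exact Monoid.pow_exponent_eq_one _
      have h2 : x ^ (q + 2) = 1 := Subtype.ext (by simpa [Subtype.ext_iff] using h1)
      rw [pow_succ', pow_mul, h2, one_pow]
    rw [Nat.card_congr (subgroupOfEquivOfLe hHK).toEquiv, hcard, hK] at hle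
    have htot : (q + 2) ∣ phi K := by
      refine dvd_trans ?_ (totient_exponent_dvd_phi K)
      rw [hk, Nat.totient_prime_pow_succ hp]
      exact (dvd_pow_self _ k.succ_ne_zero).mul_right _
    have hcop : Nat.Coprime (q + 2) (phi H) := by
      refine Nat.Coprime.coprime_dvd_left (hphi ▸ dvd_pow_self _ two_ne_zero) ?_
      simp
    have := Nat.le_of_dvd hpos (hcop.mul_dvd_of_dvd_of_dvd htot ⟨m, hm⟩)
    nlinarith

/-- A nontrivial `p`-group without subgroup `ℤ_p × ℤ_p` has at most `p` solutions of `x ^ p = 1`. -/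
theorem IsPGroup.exists_injective_or_card_pow_eq_one_le {p : ℕ} [Fact p.Prime] {G : Type*}
    [Group G] [Finite G] [Nontrivial G] (hG : IsPGroup p G) :
    (∃ f : Multiplicative (ZMod p) × Multiplicative (ZMod p) →* G, Function.Injective f) ∨
      Nat.card {x : G // x ^ p = 1} ≤ p := by
  have hp : p.Prime := Fact.out
  have := hG.center_nontrivial
  obtain ⟨⟨z, hzc⟩, hz⟩ := exists_prime_orderOf_dvd_card' (G := center G) p
    ((hG.to_subgroup _).card_eq_or_dvd.resolve_left Finite.one_lt_card.ne')
  rw [orderOf_mk] at hz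
  by_cases h : ∀ w : G, w ^ p = 1 → w ∈ zpowers z
  · right
    calc Nat.card {x : G // x ^ p = 1} ≤ Nat.card (zpowers z) :=
          Nat.card_le_card_of_injective (fun x ↦ (⟨x.1, h x.1 x.2⟩ : zpowers z))
            fun x y h ↦ Subtype.ext (congrArg (fun z ↦ z.1) h)
      _ = p := by rw [Nat.card_zpowers, hz]
  · left
    push Not at h
    obtain ⟨w, hw, hwz⟩ := h
    have hw' : orderOf w = p := orderOf_eq_prime hw fun h ↦ hwz (h ▸ one_mem _)
    obtain ⟨f, hf, hfr, -⟩ := exists_monoidHom_zmod z hz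
    obtain ⟨g, hg, hgr, -⟩ := exists_monoidHom_zmod w hw'
    have hcomm : ∀ m n, Commute (f m) (g n) := fun m n ↦ by
      have : f m ∈ center G := zpowers_le.2 hzc (hfr ▸ ⟨m, rfl⟩)
      exact ((mem_center_iff.1 this) (g n)).symm
    refine ⟨f.noncommCoprod g hcomm, (MonoidHom.noncommCoprod_injective f g hcomm).2 ⟨hf, hg, ?_⟩⟩
    rw [hfr, hgr, disjoint_def]
    intro x hxz hxw
    by_contra hx
    have hxp : zpowers x = zpowers w := by
      refine eq_of_le_of_card_ge (zpowers_le.2 hxw) ?_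
      rw [Nat.card_zpowers, Nat.card_zpowers, hw', orderOf_eq_prime (p := p) _ hx]
      exact orderOf_dvd_iff_pow_eq_one.1 ((orderOf_dvd_of_mem_zpowers hxw).trans hw'.dvd)
    exact hwz (zpowers_le.2 hxz (hxp ▸ mem_zpowers w))

theorem card_pow_eq_one_subgroup_le {G : Type*} [Group G] [Finite G] (H : Subgroup G) (n : ℕ) :
    Nat.card {x : H // x ^ n = 1} ≤ Nat.card {x : G // x ^ n = 1} :=
  Nat.card_le_card_of_injective
    (fun x ↦ (⟨x.1.1, by simpa using congrArg Subtype.val x.2⟩ : {x : G // x ^ n = 1}))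
    fun x y h ↦ Subtype.ext (Subtype.ext (congrArg (fun z ↦ z.1) h))

section Central

variable {G : Type*} [Group G] {a b c : G}

theorem pow_mul_eq_of_central (hc : ∀ g, Commute c g) (h : b * a = a * b * c) (n : ℕ) :
    b ^ n * a = a * b ^ n * c ^ n := by
  induction n with
  | zero => simp
  | succ n ih =>
    calc b ^ (n + 1) * a = b ^ n * (b * a) := by rw [pow_succ, mul_assoc]
      _ = (b ^ n * a) * (b * c) := by rw [h]; simp only [mul_assoc]
      _ = a * b ^ n * (c ^ n * b) * c := by rw [ih]; simp only [mul_assoc]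
      _ = a * b ^ (n + 1) * c ^ (n + 1) := by
        rw [((hc b).pow_left n).eq, pow_succ, pow_succ]; simp only [mul_assoc]

theorem mul_pow_eq_of_central (hc : ∀ g, Commute c g) (h : b * a = a * b * c) (n : ℕ) :
    (a * b) ^ n = a ^ n * b ^ n * c ^ n.choose 2 := by
  induction n with
  | zero => simp
  | succ n ih =>
    calc (a * b) ^ (n + 1) = a ^ n * b ^ n * (c ^ n.choose 2 * (a * b)) := by
          rw [pow_succ, ih]; simp only [mul_assoc]
      _ = a ^ n * (b ^ n * a) * (b * c ^ n.choose 2) := by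
          rw [((hc (a * b)).pow_left _).eq]; simp only [mul_assoc]
      _ = a ^ n * a * b ^ n * (c ^ n * b) * c ^ n.choose 2 := by
          rw [pow_mul_eq_of_central hc h]; simp only [mul_assoc]
      _ = a ^ (n + 1) * b ^ (n + 1) * c ^ (n + 1).choose 2 := by
        rw [((hc b).pow_left n).eq, pow_succ, pow_succ, Nat.choose_succ_succ' n 1,
          Nat.choose_one_right, pow_add]
        simp only [mul_assoc]

end Central

section Coatom

variable {p : ℕ} [Fact p.Prime] {G : Type*} [Group G] [Finite G] {M : Subgroup G}

theorem IsPGroup.index_of_isCoatom (hG : IsPGroup p G) (hM : IsCoatom M) : M.index = p := by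
  obtain ⟨K, hMK, hK⟩ := hG.exists_le_card_mul hM.1
  have hp : p.Prime := Fact.out
  have hlt : M < K := lt_of_le_of_ne hMK fun h ↦ by
    have h1 : 0 < Nat.card M := Nat.card_pos
    have h2 := hp.two_le
    rw [← h] at hK
    nlinarith
  rw [hM.2 K hlt, card_top, ← M.card_mul_index] at hK
  exact Nat.eq_of_mul_eq_mul_left Nat.card_pos hK

theorem IsPGroup.normal_of_isCoatom (hG : IsPGroup p G) (hM : IsCoatom M) : M.Normal := by
  have := hG.isNilpotent
  exact NormalizerCondition.normal_of_coatom M Group.normalizerCondition_of_isNilpotent hM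

theorem IsPGroup.commutator_le_of_isCoatom (hG : IsPGroup p G) (hM : IsCoatom M) :
    commutator G ≤ M := by
  have := hG.normal_of_isCoatom hM
  rw [← Subgroup.Normal.quotient_commutative_iff_commutator_le]
  have : IsCyclic (G ⧸ M) := isCyclic_of_prime_card (p := p) (hG.index_of_isCoatom hM)
  infer_instance

theorem IsPGroup.pow_mem_of_isCoatom (hG : IsPGroup p G) (hM : IsCoatom M) (a : G) :
    a ^ p ∈ M := by
  have := hG.normal_of_isCoatom hM
  exact hG.index_of_isCoatom hM ▸ M.pow_index_mem a

/-- The intersection of two maximal subgroups of a minimal noncyclic `p`-group is central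
with elementary abelian quotient of order `p ^ 2`. -/
theorem IsPGroup.exists_central_of_minimal_not_isCyclic (hG : IsPGroup p G)
    (hnc : ¬ IsCyclic G) (hcyc : ∀ H : Subgroup G, H ≠ ⊤ → IsCyclic H) :
    ∃ M Z : Subgroup G, M ≠ ⊤ ∧ M.index = p ∧ (∀ z ∈ Z, ∀ g, Commute z g) ∧
      (∀ a b, ∃ c ∈ Z, b * a = a * b * c) ∧ (∀ a, a ^ p ∈ Z) ∧
      Nat.card Z * p ^ 2 ≤ Nat.card G := by
  have hz (y : G) : zpowers y ≠ ⊤ := fun h ↦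
    hnc ⟨y, fun x ↦ (h ▸ mem_top x : x ∈ zpowers y)⟩
  obtain ⟨M, hM, -⟩ := (eq_top_or_exists_le_coatom (zpowers (1 : G))).resolve_left (hz 1)
  obtain ⟨y, -, hy⟩ := SetLike.exists_of_lt (lt_top_iff_ne_top.2 hM.1)
  obtain ⟨N, hN, hyN⟩ := (eq_top_or_exists_le_coatom (zpowers y)).resolve_left (hz y)
  have hNM : ¬ N ≤ M := fun h ↦ hy (h (hyN (mem_zpowers y)))
  have hMN : ¬ M ≤ N := fun h ↦
    hNM ((hM.le_iff_eq hN.1).1 h ▸ le_rfl)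
  have hcomm {L : Subgroup G} (hL : IsCoatom L) {z : G} (hzL : z ∈ L) :
      L ≤ centralizer {z} := fun x hx ↦ by
    have := hcyc L hL.1
    rw [mem_centralizer_singleton_iff]
    have := mul_comm' (⟨x, hx⟩ : L) ⟨z, hzL⟩
    exact congrArg Subtype.val this
  refine ⟨M, M ⊓ N, hM.1, hG.index_of_isCoatom hM, fun z hz g ↦ ?_, fun a b ↦ ?_, fun a ↦ ?_, ?_⟩
  · have hlt : M < centralizer {z} :=
      lt_of_le_of_ne (hcomm hM hz.1) fun h ↦ hNM (h ▸ hcomm hN hz.2)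
    have : g ∈ centralizer {z} := hM.2 _ hlt ▸ mem_top g
    exact (mem_centralizer_singleton_iff.1 this).symm
  · have : ⁅b⁻¹, a⁻¹⁆ ∈ commutator G := commutator_mem_commutator (mem_top _) (mem_top _)
    refine ⟨⁅b⁻¹, a⁻¹⁆, ⟨hG.commutator_le_of_isCoatom hM this,
      hG.commutator_le_of_isCoatom hN this⟩, ?_⟩
    simp only [commutatorElement_def]
    group
  · exact ⟨hG.pow_mem_of_isCoatom hM a, hG.pow_mem_of_isCoatom hN a⟩
  · obtain ⟨K, -, hK⟩ := (hG.to_subgroup M).exists_le_card_mul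
      (H := (M ⊓ N).subgroupOf M) fun h ↦ hMN (subgroupOf_eq_top.1 h |>.trans inf_le_right)
    rw [Nat.card_congr (subgroupOfEquivOfLe inf_le_left).toEquiv] at hK
    have := card_le_card_group K
    rw [← M.card_mul_index, hG.index_of_isCoatom hM, pow_two, ← mul_assoc, ← hK]
    gcongr

end Coatom

theorem nonempty_mulEquiv_quaternionGroup_two {G : Type*} [Group G] (hcard : Nat.card G = 8)
    {x y : G} (hx : orderOf x = 4) (hy : y ∉ zpowers x) (hyx : y ^ 2 = x ^ 2)
    (hconj : x * y = y * x⁻¹) : Nonempty (G ≃* QuaternionGroup 2) := by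
  have : Finite G := Nat.finite_of_card_ne_zero (by omega)
  obtain ⟨e, he, her, he1⟩ := exists_monoidHom_zmod x hx
  let E : ZMod (2 * 2) → G := fun i ↦ e (Multiplicative.ofAdd i)
  have hEinj : Function.Injective E := he
  have hEadd (i j : ZMod (2 * 2)) : E (i + j) = E i * E j := map_mul e _ _
  have hEneg (i : ZMod (2 * 2)) : E (-i) = (E i)⁻¹ := map_inv e _
  have hE1 : E 1 = x := he1
  have hE2 : E 2 = y * y := calc
    E 2 = E 1 * E 1 := hEadd 1 1
    _ = y * y := by rw [hE1, ← pow_two, ← pow_two, hyx]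
  have hmem (i) : E i ∈ zpowers x := her ▸ ⟨_, rfl⟩
  have hEy (i) : E i * y = y * (E i)⁻¹ := by
    obtain ⟨k, hk⟩ := hmem i
    have hk : x ^ k = E i := hk
    have h : SemiconjBy y x⁻¹ x := hconj.symm
    have := (h.zpow_right k).eq
    rw [inv_zpow, hk] at this
    exact this.symm
  let F : QuaternionGroup 2 → G
    | .a i => E i
    | .xa i => y * E i
  have hFmul : ∀ s t, F (s * t) = F s * F t := by
    rintro (i | i) (j | j)
    · exact hEadd i j
    · change y * E (j - i) = E i * (y * E j)
      rw [← mul_assoc, hEy, sub_eq_neg_add, hEadd, hEneg, mul_assoc]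
    · change y * E (i + j) = y * E i * E j
      rw [hEadd, mul_assoc]
    · change E (2 + j - i) = y * E i * (y * E j)
      rw [mul_assoc, ← mul_assoc (E i), hEy, add_sub_assoc, sub_eq_neg_add, hEadd, hEadd, hEneg,
        hE2]
      simp only [mul_assoc]
  have hne (i j) : E i ≠ y * E j := fun h ↦ hy <| by
    rw [eq_mul_inv_of_mul_eq h.symm]
    exact mul_mem (hmem i) (inv_mem (hmem j))
  have hFinj : Function.Injective F := by
    rintro (i | i) (j | j) h
    · exact congrArg _ (hEinj h)
    · exact (hne i j h).elim
    · exact (hne j i h.symm).elim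
    · exact congrArg _ (hEinj (mul_left_cancel h))
  have hF : Function.Bijective F := (Nat.bijective_iff_injective_and_card F).2
    ⟨hFinj, by rw [hcard, Nat.card_eq_fintype_card, QuaternionGroup.card]⟩
  exact ⟨(MulEquiv.ofBijective (MulHom.mk F hFmul) hF).symm⟩

section Minimal

variable {p : ℕ} [Fact p.Prime] {G : Type*} [Group G] [Finite G]

theorem IsPGroup.eq_two_of_minimal_not_isCyclic (hG : IsPGroup p G)
    (hnc : ¬ IsCyclic G) (hcyc : ∀ H : Subgroup G, H ≠ ⊤ → IsCyclic H)
    (hroot : Nat.card {x : G // x ^ p = 1} ≤ p) : p = 2 := by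
  have hp : p.Prime := Fact.out
  obtain ⟨M, Z, -, -, hZ, hcomm, hpow, hcard⟩ :=
    hG.exists_central_of_minimal_not_isCyclic hnc hcyc
  by_contra h2
  let f : G →* G := MonoidHom.mk' (fun a ↦ a ^ p) fun a b ↦ by
    obtain ⟨c, hc, h⟩ := hcomm a b
    have hcp : c ^ p = 1 := by
      have h1 := pow_mul_eq_of_central (hZ c hc) h p
      rw [(hZ _ (hpow b) a).eq] at h1
      exact left_eq_mul.1 h1
    obtain ⟨k, hk⟩ := hp.dvd_choose_self two_ne_zero (lt_of_le_of_ne hp.two_le (Ne.symm h2))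
    change (a * b) ^ p = a ^ p * b ^ p
    rw [mul_pow_eq_of_central (hZ c hc) h, hk, pow_mul, hcp, one_pow, mul_one]
  have hker : Nat.card f.ker ≤ p := hroot
  have hrange : Nat.card f.range ≤ Nat.card Z := card_le_of_le (by
    rintro _ ⟨a, rfl⟩
    exact hpow a)
  have hprod := f.ker.card_mul_index
  rw [index_ker] at hprod
  have hZpos : 0 < Nat.card Z := Nat.card_pos
  have h3 := hp.two_le
  have h4 := Nat.mul_le_mul hker hrange
  have h5 : 0 < p * Nat.card Z := by positivity
  nlinarith

theorem nonempty_mulEquiv_quaternionGroup_two_of_minimal_not_isCyclic (hG : IsPGroup 2 G)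
    (hnc : ¬ IsCyclic G) (hcyc : ∀ H : Subgroup G, H ≠ ⊤ → IsCyclic H)
    (hroot : Nat.card {x : G // x ^ 2 = 1} ≤ 2) : Nonempty (G ≃* QuaternionGroup 2) := by
  obtain ⟨M, Z, hM, hMi, hZ, hcomm, hpow, hcard⟩ :=
    hG.exists_central_of_minimal_not_isCyclic hnc hcyc
  have hZ1 : Z ≠ ⊥ := by
    rintro rfl
    have : ∀ x : G, x ^ 2 = 1 := fun x ↦ mem_bot.1 (hpow x)
    simp only [this, card_bot, Nat.card_congr (Equiv.subtypeUnivEquiv fun _ ↦ trivial)]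
      at hroot hcard
    omega
  let f : G →* G := MonoidHom.mk' (fun a ↦ a ^ 4) fun a b ↦ by
    obtain ⟨c, hc, h⟩ := hcomm a b
    have hcp : c ^ 2 = 1 := by
      have h1 := pow_mul_eq_of_central (hZ c hc) h 2
      rw [(hZ _ (hpow b) a).eq] at h1
      exact left_eq_mul.1 h1
    change (a * b) ^ 4 = a ^ 4 * b ^ 4
    rw [mul_pow_eq_of_central (hZ c hc) h, show Nat.choose 4 2 = 2 * 3 from rfl, pow_mul, hcp,
      one_pow, mul_one]
  let g : Z →* G := MonoidHom.mk' (fun z ↦ (z : G) ^ 2) fun a b ↦ (hZ a a.2 b).mul_pow 2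
  have hrange : Nat.card f.range ≤ Nat.card g.range := card_le_of_le (by
    rintro _ ⟨a, rfl⟩
    exact ⟨⟨a ^ 2, hpow a⟩, (pow_mul a 2 2).symm⟩)
  have hgker : 1 < Nat.card g.ker := by
    obtain ⟨z, hz⟩ := exists_prime_orderOf_dvd_card' (G := Z) 2
      ((hG.to_subgroup _).card_eq_or_dvd.resolve_left fun h ↦ hZ1 (card_eq_one.1 h))
    rw [one_lt_card_iff_ne_bot]
    intro h
    have hz2 : z ∈ g.ker := congrArg Subtype.val (hz ▸ pow_orderOf_eq_one z : z ^ 2 = 1)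
    rw [h, mem_bot] at hz2
    simp [hz2] at hz
  have hf := f.ker.card_mul_index
  have hg := g.ker.card_mul_index
  rw [index_ker] at hf hg
  have hfpos : 0 < Nat.card f.range := Nat.card_pos
  have hker : 8 ≤ Nat.card f.ker := by
    by_contra! h
    have h1 := Nat.mul_le_mul hgker hrange
    have h2 := Nat.mul_le_mul_right (Nat.card f.range) (Nat.le_of_lt_succ h)
    omega
  have hpow4 : ∀ x : G, x ^ 4 = 1 := by
    have : f.ker = ⊤ := by
      by_contra h
      have := hcyc _ h
      obtain ⟨x, hx⟩ := IsCyclic.exists_ofOrder_eq_natCard (α := f.ker)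
      have h4 : x ^ 4 = 1 := Subtype.ext x.2
      have := Nat.le_of_dvd (by norm_num) (orderOf_dvd_of_pow_eq_one h4)
      omega
    exact fun x ↦ (this ▸ mem_top x : x ∈ f.ker)
  obtain ⟨⟨x, hxM⟩, hx⟩ := (hcyc M hM).exists_ofOrder_eq_natCard
  rw [orderOf_mk] at hx
  have hx4 := Nat.le_of_dvd (by norm_num) (orderOf_dvd_of_pow_eq_one (hpow4 x))
  have hGM := M.card_mul_index
  rw [hMi] at hGM
  have hkG := card_le_card_group f.ker
  have hxo : orderOf x = 4 := by omega
  have hMx : zpowers x = M :=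
    eq_of_le_of_card_ge (zpowers_le.2 hxM) (by rw [Nat.card_zpowers, hx])
  have hx2 : x ^ 2 ≠ 1 := fun h ↦ by
    have := Nat.le_of_dvd (by norm_num) (orderOf_dvd_of_pow_eq_one h)
    omega
  have hinv {t : G} (ht : t ^ 2 = 1) : t = 1 ∨ t = x ^ 2 := by
    by_contra! h
    have hsub : ({1, x ^ 2, t} : Set G) ⊆ {t | t ^ 2 = 1} := by
      rintro s (rfl | rfl | rfl)
      · exact one_pow 2
      · exact (pow_mul x 2 2).symm.trans (hpow4 x)
      · exact ht
    have h1 := Set.ncard_le_ncard hsub (Set.toFinite _)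
    rw [Set.ncard_eq_three.2 ⟨1, x ^ 2, t, hx2.symm, h.1.symm, h.2.symm, rfl⟩] at h1
    exact absurd (h1.trans hroot) (by norm_num)
  have hsq {t : G} (ht : t ∉ M) : t ^ 2 = x ^ 2 := by
    refine (hinv (t := t ^ 2) ((pow_mul t 2 2).symm.trans (hpow4 t))).resolve_left fun h ↦ ?_
    rcases hinv h with rfl | rfl
    · exact ht M.one_mem
    · exact ht (M.pow_mem hxM 2)
  obtain ⟨y, -, hy⟩ := SetLike.exists_of_lt (lt_top_iff_ne_top.2 hM)
  have hxy : (x * y) ^ 2 = x ^ 2 := hsq fun h ↦ hy ((M.mul_mem_cancel_left hxM).1 h)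
  refine nonempty_mulEquiv_quaternionGroup_two (by omega) hxo (hMx ▸ hy) (hsq hy) ?_
  have h1 : y * x * y = x := by
    have : x * (y * x * y) = x * x := by simpa only [pow_two, mul_assoc] using hxy
    exact mul_left_cancel this
  have h2 : x * x * (x * x) = 1 := by
    simpa only [pow_succ, pow_zero, one_mul, mul_assoc] using hpow4 x
  have h3 : y * y = x * x := by simpa only [pow_two] using hsq hy
  calc x * y = y * x * (y * y) := by rw [← mul_assoc, h1]
    _ = y * (x * (x * x)) := by rw [h3, mul_assoc]
    _ = y * x⁻¹ := by rw [eq_inv_of_mul_eq_one_left (a := x * (x * x)) (b := x)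
          (by simpa only [mul_assoc] using h2)]

end Minimal

/-- A quaternion subgroup of order eight must be the whole group. -/
theorem eq_top_of_exponent_four_of_card_eight {G : Type*} [Group G] [Finite G]
    (hG : IsPGroup 2 G) (hdvd : ∀ H K : Subgroup G, H ≤ K → phi H ∣ phi K)
    (hroot : Nat.card {x : G // x ^ 2 = 1} ≤ 2) {H : Subgroup G}
    (hexp : Monoid.exponent H = 4) (hcard : Nat.card H = 8) : H = ⊤ := by
  by_contra hH
  obtain ⟨K, hHK, hK⟩ := hG.exists_le_card_mul hH
  rw [hcard] at hK
  have hroot1 (L : Subgroup G) : 1 ≤ Nat.card {x : L // x ^ 2 = 1} := by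
    have : Nonempty {x : L // x ^ 2 = 1} := ⟨1, one_pow 2⟩
    exact Nat.card_pos
  have hfour {L : Subgroup G} (hL : Monoid.exponent L = 4) : phi L + 2 = Nat.card L := by
    have h1 := phi_add_card_pow_eq_one (p := 2) (k := 1) hL
    rw [pow_one] at h1
    have h2 := hroot1 L
    have h3 := (card_pow_eq_one_subgroup_le L 2).trans hroot
    have h4 : Nat.totient 4 ∣ phi L := hL ▸ totient_exponent_dvd_phi L
    have h5 : 4 ∣ Nat.card L := hL ▸ Group.exponent_dvd_nat_card
    rw [show Nat.totient 4 = 2 by decide] at h4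
    omega
  have hphi : phi H = 6 := by
    have := hfour hexp
    omega
  have hd := hdvd H K hHK
  rw [hphi] at hd
  have hKp := hG.to_subgroup K
  have hpos := hKp.phi_pos
  obtain ⟨k, hk⟩ := hKp.exists_exponent_eq_pow
  match k, hk with
  | 0, hk =>
    rw [pow_zero, Monoid.exp_eq_one_iff] at hk
    rw [Nat.card_of_subsingleton (1 : K)] at hK
    omega
  | 1, hk =>
    have := phi_add_one_eq_card (hk.trans (pow_one _))
    omega
  | 2, hk =>
    have := hfour hk
    omega
  | k + 3, hk =>
    have hle := phi_add_card_le_s3 hk (H := H.subgroupOf K) fun x hx ↦ by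
      have h1 : (⟨x, hx⟩ : H) ^ 4 = 1 := by
        rw [← hexp]
        exact Monoid.pow_exponent_eq_one _
      have h2 : x ^ 4 = 1 := Subtype.ext (by simpa [Subtype.ext_iff] using h1)
      rw [add_comm, pow_add, pow_mul, show 2 ^ 2 = 4 from rfl, h2, one_pow]
    rw [Nat.card_congr (subgroupOfEquivOfLe hHK).toEquiv] at hle
    have htot : 4 ∣ phi K := by
      refine dvd_trans ?_ (totient_exponent_dvd_phi K)
      rw [hk, Nat.totient_prime_pow_succ Nat.prime_two, pow_add]
      exact ⟨2 ^ k, by ring⟩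
    omega

theorem stmt_3 (p : ℕ) [Fact p.Prime] (G : Type*) [Group G] [Finite G]
    (hG : IsPGroup p G)
    (hdvd : ∀ H K : Subgroup G, H ≤ K → phi H ∣ phi K) :
    IsCyclic G ∨ Nonempty (G ≃* QuaternionGroup 2) ∨
      Nonempty (G ≃* (Multiplicative (ZMod p) × Multiplicative (ZMod p))) := by
  by_cases hcyc : IsCyclic G
  · exact Or.inl hcyc
  right
  have : Nontrivial G := by
    by_contra h
    rw [not_nontrivial_iff_subsingleton] at h
    exact hcyc inferInstance
  rcases hG.exists_injective_or_card_pow_eq_one_le with ⟨f, hf⟩ | hroot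
  · right
    have e := f.ofInjective hf
    have hcard : Nat.card f.range = p ^ 2 := by
      rw [← Nat.card_congr e.toEquiv, Nat.card_prod, Nat.card_congr Multiplicative.toAdd,
        Nat.card_zmod, pow_two]
    have hexp : Monoid.exponent f.range = p := by
      rw [← Monoid.exponent_eq_of_mulEquiv e]
      simp [Monoid.exponent_prod]
    have htop := eq_top_of_exponent_prime_of_card_sq hG hdvd hexp hcard
    exact ⟨(MulEquiv.ofBijective f ⟨hf, MonoidHom.range_eq_top.1 htop⟩).symm⟩
  · left
    obtain ⟨H, hH, hmin⟩ := Set.Finite.exists_minimal (s := {H : Subgroup G | ¬ IsCyclic H})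
      (Set.toFinite _) ⟨⊤, fun h ↦ hcyc (topEquiv.isCyclic.1 h)⟩
    have hsub : ∀ L : Subgroup H, L ≠ ⊤ → IsCyclic L := fun L hL ↦ by
      by_contra hLc
      have hle := hmin (y := L.map H.subtype)
        (fun h ↦ hLc ((L.equivMapOfInjective _ H.subtype_injective).isCyclic.2 h))
        (map_subtype_le L)
      exact hL (eq_top_iff.2 fun x _ ↦ by
        obtain ⟨y, hy, hyx⟩ := hle x.2
        exact Subtype.ext hyx ▸ hy)
    have hHp := hG.to_subgroup H
    have hHroot := (card_pow_eq_one_subgroup_le H p).trans hroot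
    obtain rfl := hHp.eq_two_of_minimal_not_isCyclic hH hsub hHroot
    obtain ⟨e⟩ := nonempty_mulEquiv_quaternionGroup_two_of_minimal_not_isCyclic hHp hH hsub hHroot
    have htop : H = ⊤ := by
      refine eq_top_of_exponent_four_of_card_eight hG hdvd hroot ?_ ?_
      · rw [Monoid.exponent_eq_of_mulEquiv e, QuaternionGroup.exponent]
        rfl
      · rw [Nat.card_congr e.toEquiv, Nat.card_eq_fintype_card, QuaternionGroup.card]
    subst htop
    exact ⟨topEquiv.symm.trans e⟩
end
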